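/- Fix d ≥ 1, E > 0 and 0 < a ≤ b < 1. There exist C > 0 and N₀ ∈ ℕ such that for every N ≥ N₀, setting ħ = ħ_N(E), and every (x,ξ) ∈ ℝ^{2d} with H_E := H(x,ξ)/E ∈ [a,b]: | W_{ħ,N}(x,ξ) − (2πħ)^{−d+1/2} P_{E,H} cos(Ξ_{ħ,E,H}) | ≤ C ħ^{−d+3/2}, where H = H(x,ξ), P_{E,H} = ( π E^{1/2} (H_E^{−1} − 1)^{1/4} H_E^{d/2} )^{−1}, and Ξ_{ħ,E,H} = −π/4 − (2H/ħ)(H_E^{−1} − 1)^{1/2} + (2E/ħ) arccos(H_E^{1/2}). (Interior trigonometric asymptotics of the Wigner distribution, uniformly on compact subsets of the interior of the energy ball.) -/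

import Mathlib

open MeasureTheory Real Filter
open scoped BigOperators ENNReal

noncomputable section

/-- Physicists' Hermite polynomials `H_n`. -/
def physHermite : ℕ → Polynomial ℝ
  | 0 => 1
  | n + 1 => 2 * Polynomial.X * physHermite n - Polynomial.derivative (physHermite n)

/-- The `L²`-normalized Hermite function `φ_n`. -/
def hermiteFun (n : ℕ) (t : ℝ) : ℝ :=
  ((2 : ℝ) ^ n * (n.factorial : ℝ) * Real.sqrt π) ^ (-(1 : ℝ) / 2) *
    (physHermite n).eval t * Real.exp (-t ^ 2 / 2)

/-- The product Hermite function `φ_α` on `ℝ^d`. -/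
def hermiteProd {d : ℕ} (α : Fin d → ℕ) (x : Fin d → ℝ) : ℝ :=
  ∏ j, hermiteFun (α j) (x j)

/-- The rescaled Hermite eigenfunction `φ_{α,hb}(x) = hb^{-d/4} φ_α(hb^{-1/2} x)`. -/
def hermiteProdH {d : ℕ} (hb : ℝ) (α : Fin d → ℕ) (x : Fin d → ℝ) : ℝ :=
  hb ^ (-(d : ℝ) / 4) * hermiteProd α fun j => hb ^ (-(1 : ℝ) / 2) * x j

/-- The eigenspace projection kernel `Π_{hb,N}(x,y) = Σ_{|α|=N} φ_{α,hb}(x) φ_{α,hb}(y)`. -/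
def projKer (d : ℕ) (hb : ℝ) (N : ℕ) (x y : Fin d → ℝ) : ℝ :=
  ∑ α ∈ Finset.Nat.antidiagonalTuple d N, hermiteProdH hb α x * hermiteProdH hb α y

/-- Euclidean dot product on `ℝ^d`. -/
def dotR {d : ℕ} (v ξ : Fin d → ℝ) : ℝ := ∑ j, v j * ξ j

/-- The Wigner distribution of the `N`-th eigenspace projection,
`W_{hb,N}(x,ξ) = (2πhb)^{-d} ∫ Π_{hb,N}(x+v/2, x-v/2) e^{-i v·ξ/hb} dv`. -/
def wigner (d : ℕ) (hb : ℝ) (N : ℕ) (x ξ : Fin d → ℝ) : ℂ :=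
  ((((2 * π * hb) ^ d)⁻¹ : ℝ) : ℂ) *
    ∫ v : Fin d → ℝ,
      ((projKer d hb N (fun j => x j + v j / 2) (fun j => x j - v j / 2) : ℝ) : ℂ) *
        Complex.exp (-Complex.I * (dotR v ξ : ℂ) / (hb : ℂ))

/-- The classical Hamiltonian `H(x,ξ) = (|x|² + |ξ|²)/2`. -/
def Hfun {d : ℕ} (x ξ : Fin d → ℝ) : ℝ := ((∑ j, x j ^ 2) + ∑ j, ξ j ^ 2) / 2

/-- `hb_N(E) = E/(N + d/2)`, so that `E_N(hb) = hb(N + d/2) = E`. -/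
def hPl (d : ℕ) (E : ℝ) (N : ℕ) : ℝ := E / ((N : ℝ) + (d : ℝ) / 2)

/-- The Airy function `Ai(s) = (1/π) lim_{T→∞} ∫_0^T cos(t³/3 + s t) dt`. -/
def airy (s : ℝ) : ℝ :=
  (1 / π) * limUnder Filter.atTop fun T : ℝ => ∫ t in (0 : ℝ)..T, Real.cos (t ^ 3 / 3 + s * t)

open Polynomial in
lemma derivative_physHermite (n : ℕ) :
    derivative (physHermite (n+1)) = C (2 * ((n:ℝ)+1)) * physHermite n := by
  induction n with
  | zero => simp [physHermite]; first | done | rfl | (rw [C_ofNat])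
  | succ n ih =>
    have h1 : physHermite (n+2) = 2 * X * physHermite (n+1) - derivative (physHermite (n+1)) := rfl
    have h2 : physHermite (n+1) = 2 * X * physHermite n - derivative (physHermite n) := rfl
    have hd2 : derivative (2:ℝ[X]) = 0 := by rw [show (2:ℝ[X]) = C 2 from rfl, derivative_C]
    rw [h1, derivative_sub, derivative_mul, derivative_mul, ih, derivative_mul, derivative_C, hd2]
    simp only [derivative_X]
    have : derivative (physHermite n) = 2 * X * physHermite n - physHermite (n+1) := by rw [h2]; ring
    rw [this]
    push_cast
    simp only [map_mul, map_add, map_one, C_ofNat, map_natCast]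
    ring

/-- Gaussian weight. -/
def gw (ξ : ℝ) (v : ℝ) : ℂ := Complex.exp (-(1/4) * (v:ℂ)^2 + (-Complex.I * ξ) * v + 0)

lemma norm_gw (ξ v : ℝ) : ‖gw ξ v‖ = Real.exp (-(1/4) * v^2) := by
  unfold gw
  rw [Complex.norm_exp]
  congr 1
  rw [show (-(1/4) * (v:ℂ)^2 + (-Complex.I * ξ) * v + 0) = ((-(1/4) * v^2 : ℝ) : ℂ) + ((-(ξ*v) : ℝ):ℂ) * Complex.I by push_cast; ring]
  rw [Complex.add_re, Complex.ofReal_re, Complex.re_ofReal_mul]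
  simp

lemma continuous_gw (ξ : ℝ) : Continuous (gw ξ) := by unfold gw; fun_prop

lemma integrable_pow_gauss (n : ℕ) : Integrable (fun v : ℝ => v^n * Real.exp (-(1/4) * v^2)) := by
  have := integrable_rpow_mul_exp_neg_mul_sq (b := 1/4) (by norm_num) (s := n) (by
    have : (0:ℝ) ≤ n := by positivity
    linarith)
  simpa using this

lemma integrable_poly_gw (ξ : ℝ) (P : Polynomial ℂ) :
    Integrable (fun v : ℝ => P.eval (v:ℂ) * gw ξ v) := by
  induction P using Polynomial.induction_on' with
  | add p q hp hq =>
    simp only [Polynomial.eval_add, add_mul]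
    exact hp.add hq
  | monomial n a =>
    refine ((integrable_pow_gauss n).norm.const_mul ‖a‖).mono' ?_ ?_
    · have := continuous_gw ξ
      apply Continuous.aestronglyMeasurable
      simp only [Polynomial.eval_monomial]
      fun_prop
    · refine Filter.Eventually.of_forall fun v => ?_
      simp [norm_gw, mul_assoc]

/-- The functional `P ↦ ∫ P e^{-v²/4 - i ξ v}`. -/
def LamF (ξ : ℝ) (P : Polynomial ℂ) : ℂ := ∫ v : ℝ, P.eval (v:ℂ) * gw ξ v

lemma LamF_add (ξ : ℝ) (P Q) : LamF ξ (P + Q) = LamF ξ P + LamF ξ Q := by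
  unfold LamF
  rw [← integral_add (integrable_poly_gw ξ P) (integrable_poly_gw ξ Q)]
  simp [add_mul]

lemma LamF_C_mul (ξ : ℝ) (c : ℂ) (P) : LamF ξ (Polynomial.C c * P) = c * LamF ξ P := by
  unfold LamF
  rw [← integral_const_mul]
  simp [mul_assoc]

lemma LamF_sub (ξ : ℝ) (P Q) : LamF ξ (P - Q) = LamF ξ P - LamF ξ Q := by
  have := LamF_add ξ P (Polynomial.C (-1) * Q)
  rw [LamF_C_mul] at this
  rw [sub_eq_add_neg, sub_eq_add_neg, ← neg_one_mul (LamF ξ Q), ← this]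
  simp

lemma LamF_one (ξ : ℝ) : LamF ξ 1 = 2 * (Real.sqrt π : ℂ) * Complex.exp (-(ξ:ℂ)^2) := by
  unfold LamF gw
  have := integral_cexp_quadratic (b := -(1/4)) (by norm_num) (-Complex.I * ξ) 0
  simp only [Polynomial.eval_one, one_mul]
  rw [this]
  congr 1
  · rw [show (π:ℂ) / - -(1/4) = ((4 * π : ℝ) : ℂ) by push_cast; ring]
    rw [show (1/2:ℂ) = ((1/2:ℝ):ℂ) by norm_num, ← Complex.ofReal_cpow (by positivity),
      ← Real.sqrt_eq_rpow, Real.sqrt_mul (by norm_num), show (4:ℝ) = 2^2 by norm_num, Real.sqrt_sq (by norm_num)]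
    norm_num
  · congr 1
    rw [mul_pow, neg_sq, Complex.I_sq]; ring

lemma hasDerivAt_gw (ξ v : ℝ) : HasDerivAt (gw ξ) ((-(v:ℂ)/2 - Complex.I * ξ) * gw ξ v) v := by
  have h0 : HasDerivAt (fun v : ℝ => (v:ℂ)) 1 v := Complex.ofRealCLM.hasDerivAt
  have h1 := (((h0.pow 2).const_mul (-(1/4) : ℂ)).add (h0.const_mul (-Complex.I * ξ))).add_const 0
  have := h1.cexp
  unfold gw
  convert! this using 1
  simp
  ring

lemma LamF_deriv (ξ : ℝ) (P) : LamF ξ (Polynomial.derivative P) =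
    LamF ξ ((Polynomial.C (1/2) * Polynomial.X + Polynomial.C (Complex.I * ξ)) * P) := by
  rw [← sub_eq_zero, ← LamF_sub]
  unfold LamF
  have h0 : ∀ v : ℝ, HasDerivAt (fun v : ℝ => P.eval (v:ℂ) * gw ξ v)
     ((Polynomial.derivative P - (Polynomial.C (1/2) * Polynomial.X + Polynomial.C (Complex.I * ξ)) * P).eval (v:ℂ) * gw ξ v) v := by
    intro v
    have h1 := ((P.hasDerivAt (v:ℂ)).comp_ofReal).mul (hasDerivAt_gw ξ v)
    convert! h1 using 1
    simp
    ring
  exact integral_eq_zero_of_hasDerivAt_of_integrable h0 (integrable_poly_gw ξ _) (integrable_poly_gw ξ _)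

open Polynomial in
/-- shifted Hermite -/
def shH (ε : ℂ) (x : ℝ) (m : ℕ) : Polynomial ℂ :=
  ((physHermite m).map Complex.ofRealHom).comp (C (x:ℂ) + C (ε/2) * X)

open Polynomial in
lemma shH_deriv (ε : ℂ) (x : ℝ) (m : ℕ) : derivative (shH ε x (m+1)) = C (ε * (m+1)) * shH ε x m := by
  unfold shH
  rw [derivative_comp, derivative_map, derivative_physHermite]
  simp only [Polynomial.map_mul, mul_comp, map_C, C_comp]
  have h3 : C (ε/2) * C (Complex.ofRealHom (2 * ((m:ℝ)+1))) = C (ε * (m+1)) := by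
    rw [← C_mul]; congr 1; simp; ring
  rw [← h3]
  simp
  ring

open Polynomial in
lemma shH_zero_deriv (ε : ℂ) (x : ℝ) : derivative (shH ε x 0) = 0 := by
  simp [shH, physHermite]

open Polynomial in
lemma shH_succ (ε : ℂ) (x : ℝ) (m : ℕ) (hε : ε^2 = 1) : shH ε x (m+1) =
    (C (2*x:ℂ) + C ε * X) * shH ε x m - C (2*ε) * derivative (shH ε x m) := by
  have : physHermite (m+1) = 2 * X * physHermite m - derivative (physHermite m) := rfl
  unfold shH
  rw [this, derivative_comp]
  simp only [Polynomial.map_sub, Polynomial.map_mul, sub_comp, mul_comp]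
  have h2 : C ε * C (ε/2) * 2 = 1 := by
    rw [← C_ofNat 2, ← C_mul, ← C_mul, show ε * (ε/2) * 2 = ε^2 by ring, hε]; simp
  simp only [map_mul, derivative_add, derivative_C, derivative_mul, derivative_X, C_ofNat, map_X, X_comp, Polynomial.map_ofNat]
  have h3 : (2:ℂ[X]) * C (ε/2) = C ε := by rw [← C_ofNat 2, ← C_mul]; congr 1; ring
  simp only [derivative_map]
  have h4 : ∀ p : ℂ[X], (2:ℂ[X]).comp p = 2 := fun p => by rw [← C_ofNat 2, C_comp]
  simp only [h4]
  linear_combination ((Polynomial.map Complex.ofRealHom (physHermite m)).comp (C (x:ℂ) + C (ε / 2) * X) * X) * h3 + ((Polynomial.map Complex.ofRealHom (derivative (physHermite m))).comp (C (x:ℂ) + C (ε / 2) * X)) * h2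

/-- mixed moments -/
def Imn (x ξ : ℝ) (m n : ℕ) : ℂ := LamF ξ (shH 1 x m * shH (-1) x n)

open Polynomial in
lemma Imn_succ (x ξ : ℝ) (m n : ℕ) : Imn x ξ (m+1) n =
    2 * (x - Complex.I * ξ) * Imn x ξ m n + 2 * LamF ξ (shH 1 x m * derivative (shH (-1) x n)) := by
  have h := LamF_deriv ξ (shH 1 x m * shH (-1) x n)
  unfold Imn
  rw [shH_succ 1 x m (by norm_num)]
  rw [derivative_mul, LamF_add] at h
  have e1 : ((C (2*x:ℂ) + C 1 * X) * shH 1 x m - C (2*1) * derivative (shH 1 x m)) * shH (-1) x n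
    = C (2*(x - Complex.I*ξ)) * (shH 1 x m * shH (-1) x n) + C 2 * ((C (1/2) * X + C (Complex.I * ξ)) * (shH 1 x m * shH (-1) x n))
      - C 2 * (derivative (shH 1 x m) * shH (-1) x n) := by
    have : (C 2 : ℂ[X]) * C (1/2) = 1 := by rw [← C_mul]; norm_num
    simp only [map_mul, map_sub, C_1]
    linear_combination (-shH 1 x m * shH (-1) x n * X) * this
  rw [e1, LamF_sub, LamF_add, LamF_C_mul, LamF_C_mul, LamF_C_mul, ← h]
  ring

open Polynomial in
lemma Imn_zero_succ (x ξ : ℝ) (n : ℕ) : Imn x ξ 0 (n+1) = 2 * (x + Complex.I * ξ) * Imn x ξ 0 n := by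
  have h := LamF_deriv ξ (shH 1 x 0 * shH (-1) x n)
  unfold Imn
  rw [shH_succ (-1) x n (by norm_num)]
  rw [derivative_mul, LamF_add, shH_zero_deriv] at h
  have e1 : shH 1 x 0 * ((C (2*x:ℂ) + C (-1) * X) * shH (-1) x n - C (2*(-1)) * derivative (shH (-1) x n))
    = C (2*(x + Complex.I*ξ)) * (shH 1 x 0 * shH (-1) x n) - C 2 * ((C (1/2) * X + C (Complex.I * ξ)) * (shH 1 x 0 * shH (-1) x n))
      + C 2 * (shH 1 x 0 * derivative (shH (-1) x n)) := by
    have : (C 2 : ℂ[X]) * C (1/2) = 1 := by rw [← C_mul]; norm_num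
    simp only [map_mul, map_add, map_neg, C_1]
    linear_combination (shH 1 x 0 * shH (-1) x n * X) * this
  rw [e1, LamF_add, LamF_sub, LamF_C_mul, LamF_C_mul, LamF_C_mul, ← h]
  have : LamF ξ (0 * shH (-1) x n) = 0 := by simp [LamF]
  rw [this]
  ring

open Polynomial in
/-- raising operator -/
def raiseOp (ζ : ℂ) : Module.End ℂ ℂ[X] := algebraMap ℂ _ ζ + (-2:ℂ) • (derivative : ℂ[X] →ₗ[ℂ] ℂ[X])

open Polynomial in
lemma Imn_eq (x ξ : ℝ) (m : ℕ) : ∀ n, Imn x ξ m n = LamF ξ 1 *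
    ((raiseOp (2 * (x - Complex.I * ξ)) ^ m) (X^n)).eval (2 * (x + Complex.I * ξ)) := by
  induction m with
  | zero =>
    intro n
    induction n with
    | zero => simp [Imn, shH, physHermite]
    | succ n ih => rw [Imn_zero_succ, ih]; simp [pow_succ]; ring
  | succ m ih =>
    intro n
    rw [Imn_succ, ih, pow_succ, Module.End.mul_apply]
    have : raiseOp (2 * (x - Complex.I * ξ)) (X^n) = (2 * (x - Complex.I * ξ)) • X^n + (-2*n:ℂ) • X^(n-1) := by
      simp [raiseOp, Polynomial.derivative_X_pow, Algebra.algebraMap_eq_smul_one, smul_smul]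
      rw [← C_mul', ← C_mul']
      simp [mul_assoc]
    rw [this, map_add, map_smul, map_smul, eval_add, eval_smul, eval_smul]
    cases n with
    | zero =>
      rw [shH_zero_deriv]; simp [LamF]; ring
    | succ n =>
      rw [shH_deriv, show shH 1 x m * (C (-1 * ((n:ℂ)+1)) * shH (-1) x n) = C (-1 * ((n:ℂ)+1)) * (shH 1 x m * shH (-1) x n) by ring,
        LamF_C_mul]
      have := ih n
      unfold Imn at this
      rw [this]
      simp
      ring

open Polynomial in
lemma Imn_diag (x ξ : ℝ) (n : ℕ) : Imn x ξ n n = LamF ξ 1 * ((2^n * n.factorial * (-1)^n *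
    ∑ j ∈ Finset.range (n+1), (n.choose j) * (-(2*(x^2+ξ^2)))^j / j.factorial : ℝ) : ℂ) := by
  rw [Imn_eq]
  congr 1
  unfold raiseOp
  rw [Commute.add_pow (show Commute _ _ from Algebra.commutes _ _)]
  rw [LinearMap.sum_apply, eval_finset_sum, Complex.ofReal_mul, Complex.ofReal_sum, Finset.mul_sum]
  refine Finset.sum_congr rfl fun k hk => ?_
  obtain ⟨l, rfl⟩ := Nat.exists_eq_add_of_le (Nat.lt_succ_iff.mp (Finset.mem_range.mp hk))
  rw [Nat.add_sub_cancel_left, ← map_pow, _root_.smul_pow, ← map_natCast (algebraMap ℂ (Module.End ℂ ℂ[X]))]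
  simp only [Module.End.mul_apply, Module.algebraMap_end_apply, LinearMap.smul_apply, map_smul,
    Module.End.pow_apply, iterate_derivative_X_pow_eq_smul, eval_smul, eval_pow, eval_X]
  have h1 := Nat.factorial_mul_descFactorial (show l ≤ k + l by omega)
  rw [Nat.add_sub_cancel] at h1 ⊢
  have h2 : ((k.factorial:ℂ)) * ((k+l).descFactorial l : ℂ) = ((k+l).factorial : ℂ) := by exact_mod_cast h1
  have h3 : (k.factorial : ℂ) ≠ 0 := by exact_mod_cast k.factorial_ne_zero
  have h4 : (2 * (x - Complex.I * ξ) : ℂ)^k * (2 * (x + Complex.I * ξ))^k = 4^k * (x^2+ξ^2)^k := by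
    rw [← mul_pow, ← mul_pow]; congr 1
    linear_combination (-4*(ξ:ℂ)^2) * Complex.I_sq
  push_cast
  rw [← h2]
  simp only [nsmul_eq_mul, smul_eq_mul]
  have h5 : ((-1:ℂ))^k * (-1)^k = 1 := by rw [← mul_pow]; norm_num
  rw [show (-(2*((x:ℂ)^2+ξ^2)))^k = (-1)^k*2^k*(x^2+ξ^2)^k by rw [← mul_pow, ← mul_pow]; congr 1; ring]
  rw [show (-2:ℂ)^l = (-1)^l*2^l by rw [← mul_pow]; congr 1; ring]
  rw [show (4:ℂ)^k = 2^k*2^k by rw [← mul_pow]; congr 1; norm_num] at h4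
  field_simp
  simp only [pow_add]
  generalize ((k+l).choose k : ℂ) = c at *
  generalize ((k+l).descFactorial l : ℂ) = e at *
  linear_combination ((-1)^l*2^l*c) * h4 - (c*(-1)^l*2^l*2^k*2^k*(x^2+ξ^2)^k) * h5
/-- Laguerre polynomial `L_n^{(e)}`. -/
def lagE (e n : ℕ) (X : ℝ) : ℝ :=
  ∑ k ∈ Finset.range (n+1), ((n+e).choose (n-k) : ℝ) * (-X)^k / k.factorial

lemma wig1 (n : ℕ) (x ξ : ℝ) :
    Integrable (fun v : ℝ => ((hermiteFun n (x + v/2) * hermiteFun n (x - v/2) : ℝ) : ℂ) * Complex.exp (-Complex.I * (v * ξ))) ∧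
    ∫ v : ℝ, ((hermiteFun n (x + v/2) * hermiteFun n (x - v/2) : ℝ) : ℂ) * Complex.exp (-Complex.I * (v * ξ)) =
      ((2 * (-1)^n * Real.exp (-(x^2+ξ^2)) * lagE 0 n (2*(x^2+ξ^2)) : ℝ) : ℂ) := by
  have key : ∀ v : ℝ, ((hermiteFun n (x + v/2) * hermiteFun n (x - v/2) : ℝ) : ℂ) * Complex.exp (-Complex.I * (v * ξ))
     = (((2^n * n.factorial * Real.sqrt π)⁻¹ * Real.exp (-x^2) : ℝ) : ℂ) * ((shH 1 x n * shH (-1) x n).eval (v:ℂ) * gw ξ v) := by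
    intro v
    unfold hermiteFun gw shH
    set c : ℝ := 2^n * n.factorial * Real.sqrt π with hc
    have hcpos : 0 < c := by positivity
    have h1 : c ^ (-(1:ℝ)/2) * c ^ (-(1:ℝ)/2) = c⁻¹ := by
      rw [← Real.rpow_add hcpos, ← Real.rpow_neg_one]; norm_num
    have h2 : Real.exp (-(x+v/2)^2/2) * Real.exp (-(x-v/2)^2/2) = Real.exp (-x^2) * Real.exp (-(1/4)*v^2) := by
      rw [← Real.exp_add, ← Real.exp_add]; congr 1; ring
    have h3 : Complex.exp (-(1/4) * (v:ℂ)^2 + (-Complex.I * ξ) * v + 0) = ((Real.exp (-(1/4)*v^2) : ℝ) : ℂ) * Complex.exp (-Complex.I * (v * ξ)) := by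
      push_cast; rw [← Complex.exp_add]; congr 1; ring
    have e1 : ∀ y : ℝ, ((physHermite n).map Complex.ofRealHom).eval (y:ℂ) = (((physHermite n).eval y : ℝ) : ℂ) := by
      intro y; exact Polynomial.eval_map_apply (f := Complex.ofRealHom) y
    rw [h3, Polynomial.eval_mul, Polynomial.eval_comp, Polynomial.eval_comp]
    simp only [Polynomial.eval_add, Polynomial.eval_mul, Polynomial.eval_C, Polynomial.eval_X]
    rw [show (x:ℂ) + 1/2 * v = ((x + v/2 : ℝ) : ℂ) by push_cast; ring,
      show (x:ℂ) + -1/2 * v = ((x - v/2 : ℝ) : ℂ) by push_cast; ring, e1, e1]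
    have h4 : c ^ (-(1:ℝ)/2) * (physHermite n).eval (x+v/2) * Real.exp (-(x+v/2)^2/2) *
       (c ^ (-(1:ℝ)/2) * (physHermite n).eval (x-v/2) * Real.exp (-(x-v/2)^2/2)) =
       c⁻¹ * Real.exp (-x^2) * ((physHermite n).eval (x+v/2) * (physHermite n).eval (x-v/2) * Real.exp (-(1/4)*v^2)) := by
      rw [← h1]
      linear_combination (c ^ (-(1:ℝ)/2) * c ^ (-(1:ℝ)/2) * (physHermite n).eval (x+v/2) * (physHermite n).eval (x-v/2)) * h2
    rw [h4]
    push_cast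
    ring
  simp_rw [key]
  refine ⟨(integrable_poly_gw ξ _).const_mul _, ?_⟩
  rw [integral_const_mul]
  have h := Imn_diag x ξ n
  unfold Imn LamF at h
  rw [h]
  have h1 := LamF_one ξ
  unfold LamF at h1
  rw [h1]
  have h2 : Complex.exp (-(ξ:ℂ)^2) = ((Real.exp (-ξ^2) : ℝ) : ℂ) := by push_cast; rfl
  rw [h2]
  norm_cast
  have h3 : ∑ j ∈ Finset.range (n+1), (n.choose j) * (-(2*(x^2+ξ^2)))^j / j.factorial = lagE 0 n (2*(x^2+ξ^2)) := by
    unfold lagE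
    refine Finset.sum_congr rfl fun k hk => ?_
    rw [Nat.add_zero, Nat.choose_symm (Nat.lt_succ_iff.mp (Finset.mem_range.mp hk))]
  have h4 : Real.exp (-(x^2+ξ^2)) = Real.exp (-x^2) * Real.exp (-ξ^2) := by
    rw [← Real.exp_add]; congr 1; ring
  rw [h4, ← h3]
  have : Real.sqrt π ≠ 0 := by positivity
  push_cast
  field_simp

lemma wig1h (n : ℕ) (hb : ℝ) (hpos : 0 < hb) (x ξ : ℝ) :
    Integrable (fun v : ℝ => ((hermiteFun n (hb ^ (-(1:ℝ)/2) * (x + v/2)) * hermiteFun n (hb ^ (-(1:ℝ)/2) * (x - v/2)) : ℝ) : ℂ) * Complex.exp (-Complex.I * (v * ξ) / hb)) ∧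
    ∫ v : ℝ, ((hermiteFun n (hb ^ (-(1:ℝ)/2) * (x + v/2)) * hermiteFun n (hb ^ (-(1:ℝ)/2) * (x - v/2)) : ℝ) : ℂ) * Complex.exp (-Complex.I * (v * ξ) / hb) =
      ((hb ^ ((1:ℝ)/2) * (2 * (-1)^n * Real.exp (-((x^2+ξ^2)/hb)) * lagE 0 n (2*(x^2+ξ^2)/hb)) : ℝ) : ℂ) := by
  set h : ℝ := hb ^ (-(1:ℝ)/2) with hh
  have h0 : 0 < h := by positivity
  have hinv : h⁻¹ = hb ^ ((1:ℝ)/2) := by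
    rw [hh, ← Real.rpow_neg hpos.le]; norm_num
  have hsq : h^2 = hb⁻¹ := by
    rw [hh, ← Real.rpow_natCast, ← Real.rpow_mul hpos.le, ← Real.rpow_neg_one]; norm_num
  obtain ⟨i1, i2⟩ := wig1 n (h*x) (h*ξ)
  have e : (fun v : ℝ => ((hermiteFun n (h * (x + v/2)) * hermiteFun n (h * (x - v/2)) : ℝ) : ℂ) * Complex.exp (-Complex.I * (v * ξ) / hb))
    = fun v : ℝ => (fun u : ℝ => ((hermiteFun n (h*x + u/2) * hermiteFun n (h*x - u/2) : ℝ) : ℂ) * Complex.exp (-Complex.I * (u * (h*ξ:ℝ)))) (h * v) := by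
    funext v
    have : (h:ℂ)^2 = (hb:ℂ)⁻¹ := by exact_mod_cast hsq
    simp only
    rw [show h * (x + v/2) = h*x + h*v/2 by ring, show h * (x - v/2) = h*x - h*v/2 by ring]
    congr 2
    push_cast
    rw [div_eq_mul_inv, ← this]; ring
  rw [e]
  refine ⟨i1.comp_mul_left' h0.ne', ?_⟩
  rw [Measure.integral_comp_mul_left (fun u : ℝ => ((hermiteFun n (h*x + u/2) * hermiteFun n (h*x - u/2) : ℝ) : ℂ) * Complex.exp (-Complex.I * (u * (h*ξ:ℝ)))) h, i2, abs_of_pos (by positivity), hinv]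
  rw [show (h*x)^2 + (h*ξ)^2 = (x^2+ξ^2)/hb by rw [mul_pow, mul_pow, hsq]; field_simp]
  rw [Complex.real_smul, ← Complex.ofReal_mul, mul_div_assoc]

section PS
open PowerSeries

/-- `1/(1-t)` -/
def psU : PowerSeries ℝ := PowerSeries.mk 1
/-- generating function -/
def psF (e : ℕ) (x : ℝ) : PowerSeries ℝ :=
  psU ^ (e+1) * (rescale (-x) (exp ℝ)).subst (PowerSeries.X * psU)

lemma hasSubst_psU : HasSubst (PowerSeries.X * psU : PowerSeries ℝ) :=
  HasSubst.of_constantCoeff_zero' (by simp)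

lemma psF_coeff (e n : ℕ) (x : ℝ) : coeff n (psF e x) = lagE e n x := by
  unfold psF
  have h1 : ∀ j ≤ n, coeff j ((rescale (-x) (exp ℝ)).subst (PowerSeries.X * psU)) =
      ∑ k ∈ Finset.range (n+1), ((-x)^k / k.factorial) * coeff j ((PowerSeries.X * psU : PowerSeries ℝ)^k) := by
    intro j hj
    rw [coeff_subst' hasSubst_psU, finsum_eq_sum_of_support_subset (s := Finset.range (n+1))]
    · refine Finset.sum_congr rfl fun k _ => ?_
      simp [coeff_rescale, coeff_exp, div_eq_mul_inv]
    · intro k hk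
      by_contra hk2
      apply hk
      simp only [Finset.coe_range, Set.mem_Iio, not_lt] at hk2
      have : coeff j ((PowerSeries.X * psU : PowerSeries ℝ)^k) = 0 := by
        rw [mul_pow, coeff_X_pow_mul', if_neg (by omega)]
      simp [this]
  rw [coeff_mul, Finset.sum_congr rfl (g := fun p : ℕ × ℕ => ∑ k ∈ Finset.range (n+1), ((-x)^k / k.factorial) * (coeff p.1 (psU^(e+1)) * coeff p.2 ((PowerSeries.X * psU : PowerSeries ℝ)^k)))]
  · rw [Finset.sum_comm]
    unfold lagE
    refine Finset.sum_congr rfl fun k hk => ?_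
    have hk' : k ≤ n := Nat.lt_succ_iff.mp (Finset.mem_range.mp hk)
    rw [← Finset.mul_sum, ← coeff_mul, mul_pow, show psU^(e+1) * (PowerSeries.X^k * psU^k) = PowerSeries.X^k * psU^((k+e)+1) by ring,
      coeff_X_pow_mul', if_pos hk']
    unfold psU
    rw [mk_one_pow_eq_mk_choose_add, coeff_mk, show k + e + (n-k) = n + e by omega,
      ← Nat.choose_symm (show k + e ≤ n + e by omega), show n + e - (k+e) = n - k by omega]
    ring
  · intro p hp
    rw [h1 p.2 (by have := Finset.HasAntidiagonal.mem_antidiagonal.mp hp; omega), Finset.mul_sum]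
    exact Finset.sum_congr rfl fun k _ => by ring

lemma psF_mul (e : ℕ) (x y : ℝ) : psF 0 x * psF e y = psF (e+1) (x+y) := by
  unfold psF
  rw [show -(x+y) = -x + -y by ring, ← exp_mul_exp_eq_exp_add, subst_mul hasSubst_psU]
  ring

lemma psF_prod (d : ℕ) (x : Fin (d+1) → ℝ) : ∏ j, psF 0 (x j) = psF d (∑ j, x j) := by
  induction d with
  | zero => simp
  | succ d ih => rw [Fin.prod_univ_succ, ih, psF_mul, Fin.sum_univ_succ (f := x)]

lemma sum_antidiagTuple_coeff (d N : ℕ) (F : Fin d → PowerSeries ℝ) :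
    ∑ α ∈ Finset.Nat.antidiagonalTuple d N, ∏ j, coeff (α j) (F j) = coeff N (∏ j, F j) := by
  induction d generalizing N with
  | zero =>
    cases N <;> simp [coeff_one]
  | succ d ih =>
    rw [Fin.prod_univ_succ, coeff_mul]
    simp_rw [← ih, Finset.mul_sum]
    rw [Finset.sum_sigma']
    refine Finset.sum_bij' (fun α _ => ⟨(α 0, ∑ j, α (Fin.succ j)), Fin.tail α⟩) (fun p _ => Fin.cons p.1.1 p.2) ?_ ?_ ?_ ?_ ?_
    · intro α hα
      rw [Finset.Nat.mem_antidiagonalTuple, Fin.sum_univ_succ] at hα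
      simp [Finset.Nat.mem_antidiagonalTuple, hα, Fin.tail]
    · rintro ⟨⟨a, b⟩, f⟩ h
      simp [Finset.Nat.mem_antidiagonalTuple] at h
      simp [Finset.Nat.mem_antidiagonalTuple, Fin.sum_univ_succ, h]
    · intro α hα; simp
    · rintro ⟨⟨a, b⟩, f⟩ h
      simp [Finset.Nat.mem_antidiagonalTuple] at h
      simp [h]
    · intro α hα
      rw [Fin.prod_univ_succ]
      rfl

lemma sum_lag (e N : ℕ) (x : Fin (e+1) → ℝ) :
    ∑ α ∈ Finset.Nat.antidiagonalTuple (e+1) N, ∏ j, lagE 0 (α j) (x j) = lagE e N (∑ j, x j) := by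
  rw [← psF_coeff, ← psF_prod, ← sum_antidiagTuple_coeff]
  simp_rw [psF_coeff]
end PS

lemma wigner_eq (e N : ℕ) (hb : ℝ) (hpos : 0 < hb) (x ξ : Fin (e+1) → ℝ) :
    wigner (e+1) hb N x ξ = ((((π * hb)^(e+1))⁻¹ * Real.exp (-(2 * Hfun x ξ / hb)) * ((-1)^N * lagE e N (4 * Hfun x ξ / hb)) : ℝ) : ℂ) := by
  have hint : ∀ v : Fin (e+1) → ℝ, ((projKer (e+1) hb N (fun j => x j + v j / 2) (fun j => x j - v j / 2) : ℝ) : ℂ) *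
        Complex.exp (-Complex.I * (dotR v ξ : ℂ) / (hb : ℂ)) = ∑ α ∈ Finset.Nat.antidiagonalTuple (e+1) N,
        ((hb ^ (-((e+1:ℕ):ℝ)/2) : ℝ) : ℂ) * ∏ j, (((hermiteFun (α j) (hb ^ (-(1:ℝ)/2) * (x j + v j/2)) * hermiteFun (α j) (hb ^ (-(1:ℝ)/2) * (x j - v j/2)) : ℝ) : ℂ) * Complex.exp (-Complex.I * (v j * ξ j) / hb)) := by
    intro v
    unfold projKer
    rw [Complex.ofReal_sum, Finset.sum_mul]
    refine Finset.sum_congr rfl fun α _ => ?_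
    unfold hermiteProdH hermiteProd
    have h1 : Complex.exp (-Complex.I * (dotR v ξ : ℂ) / (hb : ℂ)) = ∏ j, Complex.exp (-Complex.I * (v j * ξ j) / hb) := by
      rw [← Complex.exp_sum]
      congr 1
      unfold dotR
      rw [← Finset.sum_div, ← Finset.mul_sum]; push_cast; rfl
    rw [h1, Finset.prod_mul_distrib, ← mul_assoc ((hb ^ (-((e+1:ℕ):ℝ)/2) : ℝ) : ℂ), ← Complex.ofReal_prod, ← Complex.ofReal_mul, Finset.prod_mul_distrib]
    congr 2
    have h2 : hb ^ (-((e+1:ℕ):ℝ)/2) = hb ^ (-((e+1:ℕ):ℝ)/4) * hb ^ (-((e+1:ℕ):ℝ)/4) := by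
      rw [← Real.rpow_add hpos]; congr 1; ring
    rw [h2]
    ring
  unfold wigner
  simp_rw [hint]
  rw [integral_finsetSum]
  · simp_rw [integral_const_mul]
    have h3 : ∀ α : Fin (e+1) → ℕ, ∫ v : Fin (e+1) → ℝ, ∏ j, (((hermiteFun (α j) (hb ^ (-(1:ℝ)/2) * (x j + v j/2)) * hermiteFun (α j) (hb ^ (-(1:ℝ)/2) * (x j - v j/2)) : ℝ) : ℂ) * Complex.exp (-Complex.I * (v j * ξ j) / hb))
      = ∏ j, ((hb ^ ((1:ℝ)/2) * (2 * (-1)^(α j) * Real.exp (-((x j^2+ξ j^2)/hb)) * lagE 0 (α j) (2*(x j^2+ξ j^2)/hb)) : ℝ) : ℂ) := by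
      intro α
      rw [integral_fintype_prod_volume_eq_prod (fun j (t : ℝ) => (((hermiteFun (α j) (hb ^ (-(1:ℝ)/2) * (x j + t/2)) * hermiteFun (α j) (hb ^ (-(1:ℝ)/2) * (x j - t/2)) : ℝ) : ℂ) * Complex.exp (-Complex.I * (t * ξ j) / hb)))]
      exact Finset.prod_congr rfl fun j _ => (wig1h (α j) hb hpos (x j) (ξ j)).2
    simp_rw [h3]
    simp_rw [← Complex.ofReal_prod, ← Complex.ofReal_mul]
    rw [← Complex.ofReal_sum, ← Complex.ofReal_mul]
    congr 1
    have h4 : 4 * Hfun x ξ / hb = ∑ j, 2*(x j^2+ξ j^2)/hb := by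
      unfold Hfun
      rw [← Finset.sum_div, ← Finset.mul_sum, Finset.sum_add_distrib]; ring
    have h5 : Real.exp (-(2 * Hfun x ξ / hb)) = ∏ j, Real.exp (-((x j^2+ξ j^2)/hb)) := by
      rw [← Real.exp_sum]; congr 1
      unfold Hfun
      rw [Finset.sum_neg_distrib, ← Finset.sum_div, Finset.sum_add_distrib]; ring
    rw [h4, ← sum_lag, h5, Finset.mul_sum, Finset.mul_sum, Finset.mul_sum]
    refine Finset.sum_congr rfl fun α hα => ?_
    have h6 : ∏ j, ((-1:ℝ))^(α j) = (-1)^N := by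
      rw [Finset.prod_pow_eq_pow_sum, Finset.Nat.mem_antidiagonalTuple.mp hα]
    simp only [Finset.prod_mul_distrib, h6, Finset.prod_const, Finset.card_univ, Fintype.card_fin]
    have h7 : hb ^ (-((e+1:ℕ):ℝ)/2) * (hb ^ ((1:ℝ)/2))^(e+1) = 1 := by
      rw [← Real.rpow_natCast, ← Real.rpow_mul hpos.le, ← Real.rpow_add hpos]
      convert Real.rpow_zero hb using 2
      ring
    rw [show (2*π*hb)^(e+1) = 2^(e+1) * (π*hb)^(e+1) by rw [mul_assoc, mul_pow]]
    rw [mul_inv]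
    set P := ∏ j, Real.exp (-((x j^2+ξ j^2)/hb))
    set Q := ∏ j, lagE 0 (α j) (2*(x j^2+ξ j^2)/hb)
    have h8 : ((2:ℝ)^(e+1))⁻¹ * 2^(e+1) = 1 := by field_simp
    linear_combination (((π * hb)^(e+1))⁻¹ * (-1)^N * P * Q) * h8 + (((2:ℝ)^(e+1))⁻¹ * 2^(e+1) * ((π * hb)^(e+1))⁻¹ * (-1)^N * P * Q) * h7
  · intro α _
    apply Integrable.const_mul
    exact Integrable.fintype_prod (f := fun j (t : ℝ) => (((hermiteFun (α j) (hb ^ (-(1:ℝ)/2) * (x j + t/2)) * hermiteFun (α j) (hb ^ (-(1:ℝ)/2) * (x j - t/2)) : ℝ) : ℂ) * Complex.exp (-Complex.I * (t * ξ j) / hb))) fun j => (wig1h (α j) hb hpos (x j) (ξ j)).1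
section PathInt
open Complex

/-- closed upper half-plane minus the origin -/
def upS : Set ℂ := {p | 0 ≤ p.im ∧ p ≠ 0}

/-- first segment -/
def seg1 (z0 y : ℝ) : ℂ := (1 - y : ℝ) + (z0 + y : ℝ) * I
/-- second segment -/
def seg2 (Y x : ℝ) : ℂ := (1 - Y : ℝ) + (x : ℝ) * I

/-- path integral -/
def PI (z0 Y : ℝ) (g : ℂ → ℂ) : ℂ :=
  (∫ y in (-z0)..Y, g (seg1 z0 y) * (I - 1)) + ∫ x in (z0+Y)..0, g (seg2 Y x) * I

lemma seg1_mem {z0 Y y : ℝ} (hz : 0 < z0) (hY : 1 < Y) (hy : y ∈ Set.uIcc (-z0) Y) : seg1 z0 y ∈ upS := by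
  rw [Set.uIcc_of_le (by linarith)] at hy
  obtain ⟨h1, h2⟩ := hy
  refine ⟨by simp [seg1]; linarith, fun h => ?_⟩
  have hr := congrArg Complex.re h
  have hi := congrArg Complex.im h
  simp [seg1] at hr hi
  linarith

lemma seg2_mem {z0 Y x : ℝ} (hz : 0 < z0) (hY : 1 < Y) (hy : x ∈ Set.uIcc (z0+Y) 0) : seg2 Y x ∈ upS := by
  rw [Set.uIcc_of_ge (by linarith)] at hy
  obtain ⟨h1, h2⟩ := hy
  refine ⟨by simp [seg2]; linarith, fun h => ?_⟩
  have hr := congrArg Complex.re h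
  simp [seg2] at hr
  linarith

lemma hasDerivAt_seg1 (z0 y : ℝ) : HasDerivAt (seg1 z0) (I - 1) y := by
  unfold seg1
  have h0 : HasDerivAt (fun v : ℝ => (v:ℂ)) 1 y := Complex.ofRealCLM.hasDerivAt
  have h1 := (h0.const_sub 1).add ((h0.const_add (z0:ℂ)).mul_const I)
  convert! h1 using 1
  · funext v; push_cast; simp
  · ring

lemma hasDerivAt_seg2 (Y x : ℝ) : HasDerivAt (seg2 Y) I x := by
  unfold seg2
  have h0 : HasDerivAt (fun v : ℝ => (v:ℂ)) 1 x := Complex.ofRealCLM.hasDerivAt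
  have h1 := (h0.mul_const I).const_add ((1 - Y : ℝ) : ℂ)
  convert! h1 using 1
  ring

lemma continuous_seg1 (z0 : ℝ) : Continuous (seg1 z0) := by unfold seg1; fun_prop
lemma continuous_seg2 (Y : ℝ) : Continuous (seg2 Y) := by unfold seg2; fun_prop

lemma ii1 {z0 Y : ℝ} (hz : 0 < z0) (hY : 1 < Y) {g : ℂ → ℂ} (hg : ContinuousOn g upS) :
    IntervalIntegrable (fun y => g (seg1 z0 y) * (I - 1)) volume (-z0) Y := by
  apply ContinuousOn.intervalIntegrable
  exact (hg.comp (continuous_seg1 z0).continuousOn (fun y hy => seg1_mem hz hY hy)).mul continuousOn_const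

lemma ii2 {z0 Y : ℝ} (hz : 0 < z0) (hY : 1 < Y) {g : ℂ → ℂ} (hg : ContinuousOn g upS) :
    IntervalIntegrable (fun y => g (seg2 Y y) * I) volume (z0+Y) 0 := by
  apply ContinuousOn.intervalIntegrable
  exact (hg.comp (continuous_seg2 Y).continuousOn (fun y hy => seg2_mem hz hY hy)).mul continuousOn_const

lemma PI_ftc {z0 Y : ℝ} (hz : 0 < z0) (hY : 1 < Y) {g G : ℂ → ℂ} (hg : ContinuousOn g upS)
    (hG : ∀ p ∈ upS, HasDerivAt G (g p) p) : PI z0 Y g = G ((1 - Y : ℝ)) - G ((1 + z0 : ℝ)) := by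
  unfold PI
  rw [intervalIntegral.integral_eq_sub_of_hasDerivAt (f := fun y => G (seg1 z0 y)) (fun y hy => (hG _ (seg1_mem hz hY hy)).comp_of_eq y (hasDerivAt_seg1 z0 y) rfl) (ii1 hz hY hg)]
  rw [intervalIntegral.integral_eq_sub_of_hasDerivAt (f := fun y => G (seg2 Y y)) (fun y hy => (hG _ (seg2_mem hz hY hy)).comp_of_eq y (hasDerivAt_seg2 Y y) rfl) (ii2 hz hY hg)]
  have e1 : seg1 z0 (-z0) = ((1 + z0 : ℝ) : ℂ) := by simp [seg1]
  have e2 : seg2 Y 0 = ((1 - Y : ℝ) : ℂ) := by simp [seg2]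
  have e3 : seg1 z0 Y = seg2 Y (z0+Y) := by simp [seg1, seg2]
  rw [e1, e2, e3]
  ring

lemma PI_add {z0 Y : ℝ} (hz : 0 < z0) (hY : 1 < Y) {g h : ℂ → ℂ} (hg : ContinuousOn g upS) (hh : ContinuousOn h upS) :
    PI z0 Y (fun p => g p + h p) = PI z0 Y g + PI z0 Y h := by
  unfold PI
  simp_rw [add_mul]
  rw [intervalIntegral.integral_add (ii1 hz hY hg) (ii1 hz hY hh), intervalIntegral.integral_add (ii2 hz hY hg) (ii2 hz hY hh)]
  ring

lemma PI_mul (z0 Y : ℝ) (c : ℂ) (g : ℂ → ℂ) :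
    PI z0 Y (fun p => c * g p) = c * PI z0 Y g := by
  unfold PI
  simp_rw [mul_assoc, intervalIntegral.integral_const_mul]
  ring

lemma PI_congr {z0 Y : ℝ} (hz : 0 < z0) (hY : 1 < Y) {g h : ℂ → ℂ} (hgh : ∀ p ∈ upS, g p = h p) :
    PI z0 Y g = PI z0 Y h := by
  unfold PI
  congr 1
  · exact intervalIntegral.integral_congr fun y hy => by simp only [hgh _ (seg1_mem hz hY hy)]
  · exact intervalIntegral.integral_congr fun y hy => by simp only [hgh _ (seg2_mem hz hY hy)]

lemma PI_sum {z0 Y : ℝ} (hz : 0 < z0) (hY : 1 < Y) {ι : Type} (s : Finset ι) (g : ι → ℂ → ℂ) (hg : ∀ i, ContinuousOn (g i) upS) :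
    PI z0 Y (fun p => ∑ i ∈ s, g i p) = ∑ i ∈ s, PI z0 Y (g i) := by
  classical
  induction s using Finset.induction_on with
  | empty => simp [PI]
  | insert a s ha ih =>
    simp_rw [Finset.sum_insert ha]
    rw [PI_add hz hY (hg a) (continuousOn_finsetSum _ fun i _ => hg i), ih]

lemma cont_ez (c : ℝ) (m : ℤ) : ContinuousOn (fun p : ℂ => exp (c * p) * p ^ m) upS := by
  intro p hp
  have := continuousAt_zpow₀ p m (Or.inl hp.2)
  exact ((by fun_prop : ContinuousAt (fun p : ℂ => exp (c * p)) p).mul this).continuousWithinAt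

lemma PI_rec {z0 Y : ℝ} (hz : 0 < z0) (hY : 1 < Y) (c : ℝ) (m : ℤ) :
    c * (PI z0 Y (fun p => exp (c * p) * p ^ m)).im + m * (PI z0 Y (fun p => exp (c * p) * p ^ (m-1))).im = 0 := by
  have h := PI_ftc hz hY (g := fun p => c * (exp (c * p) * p ^ m) + m * (exp (c * p) * p ^ (m-1)))
    (G := fun p => exp (c * p) * p ^ m)
    ((continuousOn_const.mul (cont_ez c m)).add (continuousOn_const.mul (cont_ez c (m-1)))) (fun p hp => by
      have h1 := (((hasDerivAt_id p).const_mul (c:ℂ)).cexp).mul (hasDerivAt_zpow m p (Or.inl hp.2))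
      convert! h1 using 1
      simp
      ring)
  rw [PI_add hz hY (g := fun p => (c:ℂ) * (Complex.exp (c * p) * p ^ m)) (h := fun p => (m:ℂ) * (Complex.exp (c * p) * p ^ (m-1))) (continuousOn_const.mul (cont_ez c m)) (continuousOn_const.mul (cont_ez c (m-1))), PI_mul, PI_mul] at h
  have h2 := congrArg Complex.im h
  have h3 : ∀ t : ℝ, (exp (c * (t:ℂ)) * (t:ℂ)^m).im = 0 := by
    intro t
    rw [← Complex.ofReal_mul, ← Complex.ofReal_exp, ← Complex.ofReal_zpow, ← Complex.ofReal_mul, Complex.ofReal_im]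
  rw [sub_im, h3, h3, add_im, im_ofReal_mul] at h2
  rw [show (m:ℂ) = ((m:ℝ):ℂ) by push_cast; rfl, im_ofReal_mul] at h2
  simpa using h2

lemma PI_inv {z0 Y : ℝ} (hz : 0 < z0) (hY : 1 < Y) : (PI z0 Y (fun p => p⁻¹)).im = π := by
  have h := PI_ftc hz hY (g := fun p => p⁻¹) (G := fun p => Complex.log (-I * p)) (fun p hp => (continuousAt_inv₀ hp.2).continuousWithinAt)
    (fun p hp => by
      have hs : -I * p ∈ slitPlane := by
        rw [mem_slitPlane_iff]
        simp
        rcases hp.1.lt_or_eq with h | h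
        · left; exact h
        · right; intro h2; exact hp.2 (Complex.ext h2 h.symm)
      have h1 := (((hasDerivAt_id p).const_mul (-I)).clog hs)
      convert! h1 using 1
      have := hp.2
      simp
      field_simp)
  rw [h, sub_im, log_im, log_im]
  have e1 : -I * ((1 - Y : ℝ):ℂ) = ((Y - 1 : ℝ) : ℂ) * I := by push_cast; ring
  have e2 : -I * ((1 + z0 : ℝ):ℂ) = ((1 + z0 : ℝ) : ℂ) * (-I) := by push_cast; ring
  rw [e1, e2, arg_real_mul _ (by linarith), arg_real_mul _ (by linarith), arg_I, arg_neg_I]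
  ring

lemma PI_base {z0 Y : ℝ} (hz : 0 < z0) (hY : 1 < Y) (c : ℝ) :
    (PI z0 Y (fun p => exp (c * p) * p ^ (-1:ℤ))).im = π := by
  set f : ℂ → ℂ := fun p => exp (c * p) with hf
  have hfd : Differentiable ℂ f := by rw [hf]; fun_prop
  have hd : Differentiable ℂ (dslope f 0) := by
    rw [← differentiableOn_univ, Complex.differentiableOn_dslope Filter.univ_mem]
    exact hfd.differentiableOn
  obtain ⟨G, hG⟩ := hd.isExactOn_univ
  have h1 := PI_ftc hz hY hd.continuous.continuousOn (fun p _ => hG p trivial)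
  have h2 : PI z0 Y (fun p => exp (c * p) * p ^ (-1:ℤ)) = PI z0 Y (dslope f 0) + PI z0 Y (fun p => p⁻¹) := by
    rw [← PI_add hz hY hd.continuous.continuousOn (fun p hp => (continuousAt_inv₀ hp.2).continuousWithinAt)]
    refine PI_congr hz hY fun p hp => ?_
    rw [dslope_of_ne _ hp.2, slope_def_field]
    have := hp.2
    simp [hf]
    field_simp
    ring
  have h3 : ∀ t : ℝ, (dslope f 0 (t:ℂ)).im = 0 := by
    intro t
    by_cases ht : t = 0
    · subst ht
      rw [ofReal_zero, dslope_same]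
      have : HasDerivAt f (Complex.exp ((c:ℂ) * 0) * ((c:ℂ) * 1)) 0 := ((hasDerivAt_id (0:ℂ)).const_mul (c:ℂ)).cexp
      rw [this.deriv]; simp
    · rw [dslope_of_ne _ (by exact_mod_cast ht), slope_def_field]
      simp only [hf]
      rw [← ofReal_mul, ← ofReal_exp]
      simp only [mul_zero, Complex.exp_zero, sub_zero]
      norm_cast
  have h4 : ∀ t : ℝ, HasDerivAt (fun t : ℝ => (G t).im) 0 t := by
    intro t
    have := (hG (t:ℂ) trivial).comp_ofReal
    have h5 := (Complex.imCLM.hasFDerivAt.comp_hasDerivAt t this)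
    rw [Complex.imCLM_apply, h3] at h5
    exact h5
  have h5 := is_const_of_deriv_eq_zero (fun t => (h4 t).differentiableAt) (fun t => (h4 t).deriv) (1-Y) (1+z0)
  rw [h2, h1, add_im, PI_inv hz hY, sub_im, h5]
  ring

lemma PI_nonneg {z0 Y : ℝ} (hz : 0 < z0) (hY : 1 < Y) {c : ℝ} (hc : c ≠ 0) (k : ℕ) :
    (PI z0 Y (fun p => exp (c * p) * p ^ (k:ℤ))).im = 0 := by
  induction k with
  | zero =>
    have := PI_rec hz hY c 0
    simp [hc] at this
    simpa using this
  | succ k ih =>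
    have := PI_rec hz hY c (k+1:ℕ)
    rw [show ((k+1:ℕ):ℤ) - 1 = (k:ℤ) by push_cast; ring, ih] at this
    simpa [hc] using this

lemma PI_neg {z0 Y : ℝ} (hz : 0 < z0) (hY : 1 < Y) {c : ℝ} (k : ℕ) :
    (PI z0 Y (fun p => exp (c * p) * p ^ (-1-(k:ℤ)))).im = π * c^k / k.factorial := by
  induction k with
  | zero => simpa using PI_base hz hY c
  | succ k ih =>
    have := PI_rec hz hY c (-1-(k:ℤ))
    rw [ih, show (-1-(k:ℤ)) - 1 = -1-((k+1:ℕ):ℤ) by push_cast; ring] at this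
    have h2 : ((k:ℝ)+1) ≠ 0 := by positivity
    have h3 : (k.factorial : ℝ) ≠ 0 := by exact_mod_cast k.factorial_ne_zero
    rw [Nat.factorial_succ]
    push_cast at this ⊢
    rw [eq_div_iff (by positivity)]
    field_simp at this
    linear_combination -this

lemma PI_lag {z0 Y : ℝ} (hz : 0 < z0) (hY : 1 < Y) {c : ℝ} (hc : c ≠ 0) (e N : ℕ) :
    (PI z0 Y (fun p => exp (c * p) * (2 - p)^(N+e) * (p^(N+1))⁻¹)).im = π * 2^e * ((-1)^N * lagE e N (2*c)) := by
  have h1 : PI z0 Y (fun p => exp (c * p) * (2 - p)^(N+e) * (p^(N+1))⁻¹) =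
      PI z0 Y (fun p => ∑ j ∈ Finset.range (N+e+1), (((-1)^j * 2^(N+e-j) * ((N+e).choose j) : ℝ) : ℂ) * (exp (c*p) * p^((j:ℤ)-N-1))) := by
    refine PI_congr hz hY fun p hp => ?_
    rw [show (2 - p) = -p + 2 by ring, add_pow, Finset.mul_sum, Finset.sum_mul]
    refine Finset.sum_congr rfl fun j _ => ?_
    have : p^((j:ℤ)-N-1) = p^j * (p^(N+1))⁻¹ := by
      rw [show ((j:ℤ)-N-1) = (j:ℤ) - ((N+1:ℕ):ℤ) by push_cast; ring, zpow_sub₀ hp.2, zpow_natCast, zpow_natCast, div_eq_mul_inv]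
    rw [this, neg_pow]
    push_cast
    ring
  rw [h1, PI_sum hz hY _ (fun (j:ℕ) p => (((-1)^j * 2^(N+e-j) * ((N+e).choose j) : ℝ) : ℂ) * (Complex.exp (c*p) * p^((j:ℤ)-N-1))) (fun j => continuousOn_const.mul (cont_ez c _)), im_sum]
  simp_rw [PI_mul, im_ofReal_mul]
  rw [show N+e+1 = (N+1)+e by ring, Finset.sum_range_add]
  have h2 : ∑ x ∈ Finset.range e, (-1:ℝ) ^ (N + 1 + x) * 2 ^ (N + e - (N + 1 + x)) * ((N + e).choose (N + 1 + x)) *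
        (PI z0 Y (fun p => exp (c * p) * p ^ (((N + 1 + x : ℕ) : ℤ) - N - 1))).im = 0 := by
    refine Finset.sum_eq_zero fun x _ => ?_
    rw [show (((N + 1 + x : ℕ) : ℤ) - N - 1) = (x:ℤ) by push_cast; ring, PI_nonneg hz hY hc, mul_zero]
  rw [h2, add_zero, ← Finset.sum_range_reflect]
  unfold lagE
  rw [Finset.mul_sum, Finset.mul_sum]
  refine Finset.sum_congr rfl fun k hk => ?_
  have hk' : k ≤ N := Nat.lt_succ_iff.mp (Finset.mem_range.mp hk)
  obtain ⟨l, rfl⟩ := Nat.exists_eq_add_of_le hk'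
  rw [show k + l + 1 - 1 - k = l by omega, show ((l:ℤ) - ((k+l:ℕ):ℤ) - 1) = -1-(k:ℤ) by push_cast; ring, PI_neg hz hY,
    show k + l + e - l = k + e by omega, show k + l - k = l by omega]
  have h5 : ((-1:ℝ))^k * (-1)^k = 1 := by rw [← mul_pow]; norm_num
  rw [show (-(2*c))^k = (-1)^k*2^k*c^k by rw [← mul_pow, ← mul_pow]; congr 1; ring, pow_add, pow_add]
  linear_combination (-(π * 2^e*2^k*c^k*(-1)^l/k.factorial * (k+l+e).choose l)) * h5

end PathInt
lemma exp_sub_one_sub (S : ℂ) : ‖Complex.exp S - 1 - S‖ ≤ ‖S‖^2 * Real.exp ‖S‖ := by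
  have h := Complex.norm_exp_sub_sum_le_norm_mul_exp S 2
  simp [Finset.sum_range_succ] at h
  rw [show Complex.exp S - 1 - S = Complex.exp S - (1 + S) by ring]
  exact h

lemma poly_exp_bound {κ : ℝ} (hκ : 0 < κ) : ∃ C : ℝ, 0 < C ∧ ∀ u : ℝ, 0 ≤ u → u + u^2 + u^3 ≤ C * Real.exp (κ * u) := by
  refine ⟨1/κ + 2/κ^2 + 6/κ^3, by positivity, fun u hu => ?_⟩
  have hk : 0 ≤ κ * u := by positivity
  have h1 := Real.pow_div_factorial_le_exp (κ*u) hk 1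
  have h2 := Real.pow_div_factorial_le_exp (κ*u) hk 2
  have h3 := Real.pow_div_factorial_le_exp (κ*u) hk 3
  simp [Nat.factorial] at h1 h2 h3
  have e1 : u = 1/κ * (κ * u) := by field_simp
  have e2 : u^2 = 2/κ^2 * ((κ * u)^2/2) := by field_simp
  have e3 : u^3 = 6/κ^3 * ((κ * u)^3/6) := by field_simp
  rw [add_mul, add_mul]
  refine add_le_add (add_le_add ?_ ?_) ?_
  · rw [e1]; calc _ ≤ 1/κ * Real.exp (κ*u) := by gcongr
      _ = _ := by rw [← e1]
  · rw [e2]; gcongr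
  · rw [e3]; gcongr

lemma odd_int (κ δ : ℝ) (a1 b3 : ℂ) :
    ∫ y in (-δ)..δ, ((Real.exp (-κ * y^2) : ℝ) : ℂ) * (a1 * y + b3 * y^3) = 0 := by
  have h := intervalIntegral.integral_comp_neg (a := -δ) (b := δ) (fun y : ℝ => ((Real.exp (-κ * y^2) : ℝ) : ℂ) * (a1 * y + b3 * y^3))
  rw [neg_neg] at h
  have h2 : ∫ y in (-δ)..δ, ((Real.exp (-κ * (-y)^2) : ℝ) : ℂ) * (a1 * ((-y : ℝ):ℂ) + b3 * ((-y : ℝ):ℂ)^3) =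
     - ∫ y in (-δ)..δ, ((Real.exp (-κ * y^2) : ℝ) : ℂ) * (a1 * y + b3 * y^3) := by
    rw [← intervalIntegral.integral_neg]
    congr 1
    funext y
    rw [neg_sq]; push_cast; ring
  rw [h2] at h
  have h3 : (2:ℂ) * ∫ y in (-δ)..δ, ((Real.exp (-κ * y^2) : ℝ) : ℂ) * (a1 * y + b3 * y^3) = 0 := by
    linear_combination -h
  simpa using h3

set_option maxHeartbeats 2000000 in
lemma laplace {κ0 K δ : ℝ} (hκ0 : 0 < κ0) (hK : 0 < K) (hδ : 0 < δ) (hδ1 : δ ≤ 1) (hδ2 : 8 * K * δ ≤ κ0) :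
    ∃ C : ℝ, 0 < C ∧ ∀ (κ l : ℝ) (a1 b3 : ℂ) (Φ : ℝ → ℂ), κ0 ≤ κ → 1 ≤ l → ‖a1‖ ≤ K → ‖b3‖ ≤ K →
      ContinuousOn Φ (Set.Icc (-δ) δ) →
      (∀ y : ℝ, |y| ≤ δ → ‖Φ y - (-(κ * l * y^2 : ℝ) + a1 * y + l * b3 * y^3)‖ ≤ K * (y^2 + l * y^4)) →
      ‖(∫ y in (-δ)..δ, Complex.exp (Φ y)) - (√(π / (κ * l)) : ℝ)‖ ≤ C / (l * √l) := by
  obtain ⟨C2, hC2, hC2b⟩ := poly_exp_bound (κ := κ0/4) (by positivity)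
  set C3 : ℝ := (8*K^2*Real.exp (2*K) + K + 1/δ^2) * C2 with hC3
  have hC3p : 0 < C3 := by positivity
  refine ⟨C3 * √(π / (κ0/2)), by positivity, ?_⟩
  intro κ l a1 b3 Φ hκ hl ha1 hb3 hΦ hexp
  have hl0 : 0 < l := by linarith
  -- integrability
  have iG : Integrable (fun y : ℝ => C3 / l * Real.exp (-(κ0/2*l) * y^2)) :=
    (integrable_exp_neg_mul_sq (by positivity)).const_mul _
  have iM : Integrable (fun y : ℝ => ((Real.exp (-(κ*l) * y^2) : ℝ):ℂ)) :=
    (integrable_exp_neg_mul_sq (by nlinarith)).ofReal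
  have hset : MeasurableSet (Set.Ioc (-δ) δ) := measurableSet_Ioc
  have iP : IntegrableOn (fun y : ℝ => Complex.exp (Φ y) - ((Real.exp (-(κ*l) * y^2) : ℝ):ℂ) * (a1 * y + l * b3 * y^3)) (Set.Ioc (-δ) δ) := by
    refine IntegrableOn.mono_set (t := Set.Icc (-δ) δ) ?_ Set.Ioc_subset_Icc_self
    apply ContinuousOn.integrableOn_Icc
    refine ContinuousOn.sub hΦ.cexp (Continuous.continuousOn (by fun_prop))
  have iE : IntegrableOn (fun y : ℝ => Complex.exp (Φ y)) (Set.Ioc (-δ) δ) := by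
    refine IntegrableOn.mono_set (t := Set.Icc (-δ) δ) ?_ Set.Ioc_subset_Icc_self
    exact ContinuousOn.integrableOn_Icc hΦ.cexp
  have iO : IntegrableOn (fun y : ℝ => ((Real.exp (-(κ*l) * y^2) : ℝ):ℂ) * (a1 * y + l * b3 * y^3)) (Set.Ioc (-δ) δ) := by
    refine IntegrableOn.mono_set (t := Set.Icc (-δ) δ) ?_ Set.Ioc_subset_Icc_self
    exact ContinuousOn.integrableOn_Icc (Continuous.continuousOn (by fun_prop))
  have key : (∫ y in (-δ)..δ, Complex.exp (Φ y)) - (√(π / (κ * l)) : ℝ) =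
      ∫ y : ℝ, ((Set.Ioc (-δ) δ).indicator (fun y : ℝ => Complex.exp (Φ y) - ((Real.exp (-(κ*l) * y^2) : ℝ):ℂ) * (a1 * y + l * b3 * y^3)) y -
        ((Real.exp (-(κ*l) * y^2) : ℝ):ℂ)) := by
    rw [integral_sub ((integrable_indicator_iff hset).2 iP) iM, integral_indicator hset, integral_sub iE iO,
      ← intervalIntegral.integral_of_le (by linarith), ← intervalIntegral.integral_of_le (by linarith), odd_int, sub_zero]
    congr 1
    rw [← integral_gaussian (κ*l)]
    exact integral_ofReal.symm
  have hgauss : ∫ y : ℝ, C3 / l * Real.exp (-(κ0/2*l) * y^2) = C3 * √(π / (κ0/2)) / (l * √l) := by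
    rw [integral_const_mul, integral_gaussian, ← div_div, Real.sqrt_div' _ hl0.le]
    field_simp
  rw [key, ← hgauss]
  refine norm_integral_le_of_norm_le iG (Filter.Eventually.of_forall fun y => ?_)
  -- pointwise
  have hu : 0 ≤ l * y^2 := by positivity
  have hpoly := hC2b (l*y^2) hu
  have hee : Real.exp (κ0/4*(l*y^2)) * Real.exp (-(3*κ0/4*l)*y^2) = Real.exp (-(κ0/2*l) * y^2) := by
    rw [← Real.exp_add]; congr 1; ring
  have hmono : Real.exp (-(κ*l)*y^2) ≤ Real.exp (-(κ0*l)*y^2) := by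
    apply Real.exp_le_exp.2; nlinarith
  have hmono2 : Real.exp (-(κ0*l)*y^2) ≤ Real.exp (-(3*κ0/4*l)*y^2) := by
    apply Real.exp_le_exp.2; nlinarith
  have hfin : ∀ D : ℝ, 0 ≤ D → D ≤ 8*K^2*Real.exp (2*K) + K + 1/δ^2 →
      D * ((l*y^2 + (l*y^2)^2+(l*y^2)^3)/l) * Real.exp (-(3*κ0/4*l)*y^2) ≤ C3 / l * Real.exp (-(κ0/2*l) * y^2) := by
    intro D hD hD2
    rw [← hee, hC3]
    calc _ ≤ (8*K^2*Real.exp (2*K) + K + 1/δ^2) * ((C2 * Real.exp (κ0/4*(l*y^2)))/l) * Real.exp (-(3*κ0/4*l)*y^2) := by gcongr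
      _ = _ := by ring
  have hu2 : y^2 ≤ (l*y^2 + (l*y^2)^2+(l*y^2)^3)/l := by
    rw [le_div_iff₀ hl0]; nlinarith [sq_nonneg (l*y^2), pow_nonneg hu 3]
  by_cases hy : y ∈ Set.Ioc (-δ) δ
  · rw [Set.indicator_of_mem hy]
    have hyd : |y| ≤ δ := abs_le.2 ⟨hy.1.le, hy.2⟩
    have h1 := hexp y hyd
    set S : ℂ := Φ y + (κ * l * y^2 : ℝ) with hS
    have hT : ‖S - (a1 * y + l * b3 * y^3)‖ ≤ K * (y^2 + l*y^4) := by
      convert! h1 using 2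
      rw [hS]; ring
    have hy1 : |y| ≤ 1 := hyd.trans hδ1
    have hy0 := abs_nonneg y
    have ysq : y^2 = |y|^2 := (sq_abs y).symm
    have yq : y^4 = |y|^4 := by rw [show y^4 = (y^2)^2 by ring, ysq]; ring
    have hO : ‖a1 * y + l * b3 * y^3‖ ≤ K * (|y| + l * |y|^3) := by
      calc _ ≤ ‖a1‖ * |y| + l * ‖b3‖ * |y|^3 := by
            refine (norm_add_le _ _).trans (le_of_eq ?_)
            simp [abs_of_pos hl0]
        _ ≤ K * |y| + l * K * |y|^3 := by gcongr
        _ = _ := by ring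
    have hSn : ‖S‖ ≤ 2 * K * (|y| + l * |y|^3) := by
      have : ‖S‖ ≤ ‖S - (a1 * y + l * b3 * y^3)‖ + ‖a1 * y + l * b3 * y^3‖ := by
        have := norm_add_le (S - (a1 * y + l * b3 * y^3)) (a1 * y + l * b3 * y^3)
        rwa [sub_add_cancel] at this
      have h5 : y^2 + l * y^4 ≤ |y| + l * |y|^3 := by
        rw [ysq, yq]
        have : |y|^4 ≤ |y|^3 := pow_le_pow_of_le_one hy0 hy1 (by norm_num)
        have : |y|^2 ≤ |y| := by nlinarith
        gcongr
      linarith [mul_le_mul_of_nonneg_left h5 hK.le]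
    have hSn2 : ‖S‖ ≤ 2 * K + κ0/4*(l*y^2) := by
      refine hSn.trans ?_
      have : l * |y|^3 ≤ δ * (l*y^2) := by
        rw [ysq, show l*|y|^3 = |y| * (l*|y|^2) by ring]; gcongr
      have h6 : 2 * K * (δ * (l*y^2)) ≤ κ0/4*(l*y^2) := by
        rw [← mul_assoc]; gcongr; linarith
      have h7 : 2*K*(l*|y|^3) ≤ 2*K*(δ * (l*y^2)) := by gcongr
      have h8 : 2*K*|y| ≤ 2*K*1 := by gcongr
      linarith
    have hSsq : ‖S‖^2 ≤ 8*K^2*(y^2 + l^2*y^6) := by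
      calc _ ≤ (2 * K * (|y| + l * |y|^3))^2 := by gcongr
        _ ≤ 8*K^2*(|y|^2 + l^2*|y|^6) := by
          linarith [mul_nonneg (sq_nonneg K) (sq_nonneg (|y| - l*|y|^3)), show (2 * K * (|y| + l * |y|^3))^2 = 8*K^2*(|y|^2 + l^2*|y|^6) - 4*(K^2*(|y| - l*|y|^3)^2) by ring]
        _ = _ := by rw [ysq, show y^6 = (y^2)^3 by ring, ysq]; ring
    have hEq : Complex.exp (Φ y) - ((Real.exp (-(κ*l) * y^2) : ℝ):ℂ) * (a1 * y + l * b3 * y^3) - ((Real.exp (-(κ*l) * y^2) : ℝ):ℂ)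
       = ((Real.exp (-(κ*l) * y^2) : ℝ):ℂ) * ((Complex.exp S - 1 - S) + (S - (a1 * y + l * b3 * y^3))) := by
      have : Complex.exp (Φ y) = ((Real.exp (-(κ*l) * y^2) : ℝ):ℂ) * Complex.exp S := by
        rw [Complex.ofReal_exp, ← Complex.exp_add]; congr 1; rw [hS]; push_cast; ring
      rw [this]; ring
    rw [hEq, norm_mul, Complex.norm_real, Real.norm_of_nonneg (Real.exp_pos _).le]
    have hbr : ‖(Complex.exp S - 1 - S) + (S - (a1 * y + l * b3 * y^3))‖ ≤
        8*K^2*(y^2 + l^2*y^6) * (Real.exp (2*K) * Real.exp (κ0/4*(l*y^2))) + K * (y^2 + l*y^4) := by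
      refine (norm_add_le _ _).trans (add_le_add ((exp_sub_one_sub S).trans ?_) hT)
      rw [← Real.exp_add]
      gcongr
    have hB1 : Real.exp (-(κ*l) * y^2) * Real.exp (κ0/4*(l*y^2)) ≤ Real.exp (-(3*κ0/4*l)*y^2) := by
      rw [← Real.exp_add]; apply Real.exp_le_exp.2; nlinarith
    have hp1 : y^2 + l^2*y^6 ≤ (l*y^2 + (l*y^2)^2+(l*y^2)^3)/l := by
      rw [le_div_iff₀ hl0]; nlinarith [sq_nonneg (l*y^2)]
    have hp2 : y^2 + l*y^4 ≤ (l*y^2 + (l*y^2)^2+(l*y^2)^3)/l := by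
      rw [le_div_iff₀ hl0]; nlinarith [pow_nonneg hu 3]
    set Q := (l*y^2 + (l*y^2)^2+(l*y^2)^3)/l with hQ
    calc _ ≤ Real.exp (-(κ*l) * y^2) * (8*K^2*(y^2 + l^2*y^6) * (Real.exp (2*K) * Real.exp (κ0/4*(l*y^2))) + K * (y^2 + l*y^4)) := by gcongr
      _ = 8*K^2*Real.exp (2*K)*(y^2 + l^2*y^6) * (Real.exp (-(κ*l) * y^2) * Real.exp (κ0/4*(l*y^2))) + K * (y^2 + l*y^4) * Real.exp (-(κ*l) * y^2) := by ring
      _ ≤ 8*K^2*Real.exp (2*K)*Q * Real.exp (-(3*κ0/4*l)*y^2) + K * Q * Real.exp (-(3*κ0/4*l)*y^2) := by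
          gcongr
          linarith
      _ = (8*K^2*Real.exp (2*K) + K) * Q * Real.exp (-(3*κ0/4*l)*y^2) := by ring
      _ ≤ _ := hfin _ (by positivity) (by have : 0 ≤ 1/δ^2 := by positivity
                                          linarith)
  · rw [Set.indicator_of_notMem hy, zero_sub, norm_neg, Complex.norm_real, Real.norm_of_nonneg (Real.exp_pos _).le]
    have hyd : δ ≤ |y| := by
      by_contra hcon
      push Not at hcon
      exact hy ⟨(abs_lt.1 hcon).1, (abs_lt.1 hcon).2.le⟩
    have h7 : 1 ≤ 1/δ^2 * y^2 := by
      rw [one_div, inv_mul_eq_div, le_div_iff₀ (by positivity), one_mul, ← sq_abs y]; gcongr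
    refine le_trans ?_ (hfin (1/δ^2) (by positivity) (by have : 0 < 8*K^2*Real.exp (2*K) := by positivity
                                                         linarith))
    calc _ ≤ 1 * Real.exp (-(3*κ0/4*l)*y^2) := by rw [one_mul]; exact hmono.trans hmono2
      _ ≤ (1/δ^2 * y^2) * Real.exp (-(3*κ0/4*l)*y^2) := by gcongr
      _ ≤ _ := by gcongr
lemma log3 {w : ℂ} (hw : ‖w‖ ≤ 1/2) : ‖Complex.log (1+w) - (w - w^2/2 + w^3/3)‖ ≤ ‖w‖^4/2 := by
  have h := Complex.norm_log_sub_logTaylor_le 3 (z := w) (by linarith)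
  simp [Complex.logTaylor, Finset.sum_range_succ] at h
  have h2 : (1 - ‖w‖)⁻¹ ≤ 2 := by
    rw [inv_le_comm₀ (by linarith) (by norm_num)]; linarith
  have h3 : ‖w‖^4 * (1-‖w‖)⁻¹ / (3+1) ≤ ‖w‖^4/2 := by
    have : ‖w‖^4 * (1-‖w‖)⁻¹ ≤ ‖w‖^4*2 := by gcongr
    linarith
  refine le_trans (le_of_eq ?_) (h.trans h3)
  congr 1; ring

lemma log1 {w : ℂ} (hw : ‖w‖ ≤ 1/2) : ‖Complex.log (1+w) - w‖ ≤ ‖w‖^2 := by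
  have h := Complex.norm_log_sub_logTaylor_le 1 (z := w) (by linarith)
  simp [Complex.logTaylor, Finset.sum_range_succ] at h
  have h2 : (1 - ‖w‖)⁻¹ ≤ 2 := by
    rw [inv_le_comm₀ (by linarith) (by norm_num)]; linarith
  have h3 : ‖w‖^2 * (1-‖w‖)⁻¹ / (1+1) ≤ ‖w‖^2 := by
    have : ‖w‖^2 * (1-‖w‖)⁻¹ ≤ ‖w‖^2*2 := by gcongr
    linarith
  exact h.trans h3

/-- the saddle point -/
def sp (z0 : ℝ) : ℂ := 1 + z0 * Complex.I

lemma sp_norm_ge (z0 : ℝ) : 1 ≤ ‖sp z0‖ := by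
  have := Complex.abs_re_le_norm (sp z0)
  simpa [sp] using this

lemma sp_ne (z0 : ℝ) : sp z0 ≠ 0 := by
  intro h; have := sp_norm_ge z0; rw [h] at this; simp at this; linarith

lemma sp_neg_ne (z0 : ℝ) : (1 - z0 * Complex.I : ℂ) ≠ 0 := by
  have := sp_ne (-z0); simpa [sp, sub_eq_add_neg] using this

lemma eta_norm : ‖(Complex.I - 1 : ℂ)‖ = √2 := by
  rw [Complex.norm_def, Complex.normSq_apply]; norm_num

lemma w_norm (z0 y : ℝ) : ‖(Complex.I - 1) * y / sp z0‖ ≤ √2 * |y| := by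
  rw [norm_div, norm_mul, eta_norm, Complex.norm_real, Real.norm_eq_abs]
  exact div_le_self (by positivity) (sp_norm_ge z0)

/-- local exponent -/
def Phi (g l z0 y : ℝ) : ℂ :=
  (l * (2/(1+z0^2)) : ℝ) * ((Complex.I - 1) * y)
   + (l+g : ℝ) * Complex.log (1 + -((Complex.I - 1) * y / sp (-z0)))
   - (l-g : ℝ) * Complex.log (1 + (Complex.I - 1) * y / sp z0)

lemma Phi_cont (g l z0 : ℝ) : ContinuousOn (Phi g l z0) (Set.Icc (-(1/4)) (1/4)) := by
  have h2 : √2 ≤ 3/2 := by rw [Real.sqrt_le_left (by norm_num)]; norm_num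
  have hs : ∀ w : ℂ, ‖w‖ ≤ 1/2 → 1 + w ∈ Complex.slitPlane := by
    intro w hw
    exact Complex.mem_slitPlane_of_norm_lt_one (by linarith)
  have hw : ∀ z y : ℝ, y ∈ Set.Icc (-(1/4)) (1/4:ℝ) → ‖(Complex.I - 1) * y / sp z‖ ≤ 1/2 := by
    intro z y hy
    have := w_norm z y
    have h3 : |y| ≤ 1/4 := abs_le.2 hy
    have : √2 * |y| ≤ 3/2 * (1/4) := by gcongr
    linarith
  unfold Phi
  refine ContinuousOn.sub (ContinuousOn.add (Continuous.continuousOn (by fun_prop)) (continuousOn_const.mul ?_)) (continuousOn_const.mul ?_)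
  · refine ContinuousOn.clog (Continuous.continuousOn (by fun_prop)) fun y hy => hs _ ?_
    rw [norm_neg]; exact hw _ _ hy
  · exact ContinuousOn.clog (Continuous.continuousOn (by fun_prop)) fun y hy => hs _ (hw _ _ hy)

lemma Phi_exp (g l z0 : ℝ) (hl : 0 ≤ l) : ∃ a1 b3 : ℂ, ‖a1‖ ≤ 4 + 4 * |g| ∧ ‖b3‖ ≤ 4 + 4*|g| ∧
    ∀ y : ℝ, |y| ≤ 1/4 → ‖Phi g l z0 y - (-(4 * z0 / (1+z0^2)^2 * l * y^2 : ℝ) + a1 * y + l * b3 * y^3)‖ ≤ (4+4*|g|) * (y^2 + l * y^4) := by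
  have h2 : √2 ≤ 3/2 := by rw [Real.sqrt_le_left (by norm_num)]; norm_num
  have h2sq : √2^2 = 2 := Real.sq_sqrt (by norm_num)
  set u : ℂ := (Complex.I - 1) / sp (-z0) with hu
  set v : ℂ := (Complex.I - 1) / sp z0 with hv
  have hun : ‖u‖ ≤ √2 := by have := w_norm (-z0) 1; rw [hu]; simpa using this
  have hvn : ‖v‖ ≤ √2 := by have := w_norm z0 1; rw [hv]; simpa using this
  have hg := abs_nonneg g
  refine ⟨g * (v - u), -(u^3+v^3)/3, ?_, ?_, fun y hy => ?_⟩
  · rw [norm_mul, Complex.norm_real, Real.norm_eq_abs]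
    calc _ ≤ |g| * (‖v‖ + ‖u‖) := by gcongr; exact norm_sub_le _ _
      _ ≤ |g| * (3/2+3/2) := by gcongr <;> linarith
      _ ≤ _ := by linarith
  · rw [norm_div, norm_neg]
    calc _ ≤ (‖u‖^3 + ‖v‖^3)/‖(3:ℂ)‖ := by
          gcongr; exact (norm_add_le _ _).trans (by simp)
      _ ≤ ((3/2)^3+(3/2)^3)/3 := by
          have : ‖(3:ℂ)‖ = 3 := by simp
          rw [this]; gcongr <;> linarith
      _ ≤ _ := by linarith
  · have hun' : ‖u*y‖ ≤ √2 * |y| := by rw [norm_mul, Complex.norm_real, Real.norm_eq_abs]; gcongr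
    have hvn' : ‖v*y‖ ≤ √2 * |y| := by rw [norm_mul, Complex.norm_real, Real.norm_eq_abs]; gcongr
    have hsm : √2*|y| ≤ 1/2 := by
      have : √2 * |y| ≤ 3/2 * (1/4) := by gcongr
      linarith
    have p2 : (√2*|y|)^2 = 2*y^2 := by rw [mul_pow, h2sq, sq_abs]
    have p4 : (√2*|y|)^4 = 4*y^4 := by rw [show (√2*|y|)^4 = ((√2*|y|)^2)^2 by ring, p2]; ring
    have hu3 := log3 (w := -(u*y)) (by rw [norm_neg]; linarith)
    have hu1 := log1 (w := -(u*y)) (by rw [norm_neg]; linarith)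
    have hv3 := log3 (w := v*y) (by linarith)
    have hv1 := log1 (w := v*y) (by linarith)
    rw [norm_neg] at hu3 hu1
    have bu2 : ‖u*y‖^2 ≤ 2*y^2 := by rw [← p2]; gcongr
    have bv2 : ‖v*y‖^2 ≤ 2*y^2 := by rw [← p2]; gcongr
    have bu4 : ‖u*y‖^4 ≤ 4*y^4 := by rw [← p4]; gcongr
    have bv4 : ‖v*y‖^4 ≤ 4*y^4 := by rw [← p4]; gcongr
    set Lu := Complex.log (1 + -(u*y)) with hLu
    set Lv := Complex.log (1 + v*y) with hLv
    have e1 : Phi g l z0 y = (l * (2/(1+z0^2)) : ℝ) * ((Complex.I - 1) * y) + (l+g:ℝ) * Lu - (l-g:ℝ) * Lv := by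
      rw [hLu, hLv, hu, hv]; unfold Phi; congr 4 <;> ring_nf
    have hz2 : (1 + (z0:ℂ)^2) ≠ 0 := by
      have : (1 + z0^2 : ℝ) ≠ 0 := by positivity
      exact_mod_cast this
    have hm1 : sp z0 * sp (-z0) = 1 + z0^2 := by
      unfold sp; push_cast; linear_combination (-(z0:ℂ)^2) * Complex.I_sq
    have hu' : u = (Complex.I - 1) * sp z0 / (1+z0^2) := by
      rw [hu, ← hm1]; have := sp_ne z0; have := sp_ne (-z0); field_simp
    have hv' : v = (Complex.I - 1) * sp (-z0) / (1+z0^2) := by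
      rw [hv, ← hm1]; have := sp_ne z0; have := sp_ne (-z0); field_simp
    have lin : (2/(1+(z0:ℂ)^2)) * (Complex.I - 1) = u + v := by
      rw [hu', hv']; unfold sp; push_cast; field_simp; ring
    have quad : v^2 - u^2 = -(8 * z0/(1+(z0:ℂ)^2)^2) := by
      rw [hu', hv']; unfold sp; push_cast; field_simp
      linear_combination (-4*(z0:ℂ)*Complex.I + 8 * z0) * Complex.I_sq
    have e2 : Phi g l z0 y - (-(4 * z0 / (1+z0^2)^2 * l * y^2 : ℝ) + g * (v - u) * y + l * (-(u^3+v^3)/3) * y^3)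
       = l * (Lu - (-(u*y) - (-(u*y))^2/2 + (-(u*y))^3/3)) - l * (Lv - (v*y - (v*y)^2/2+(v*y)^3/3))
         + g * (Lu - -(u*y)) + g * (Lv - v*y) := by
      rw [e1]; push_cast
      linear_combination ((l:ℂ)*y) * lin + ((l:ℂ)*y^2/2) * quad
    rw [e2]
    have nl : ‖(l:ℂ)‖ = l := by simp [abs_of_nonneg hl]
    have ng : ‖(g:ℂ)‖ = |g| := by simp
    calc _ ≤ l * (‖u*y‖^4/2) + l * (‖v*y‖^4/2) + |g| * ‖u*y‖^2 + |g| * ‖v*y‖^2 := by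
          refine (norm_add_le _ _).trans (add_le_add ((norm_add_le _ _).trans (add_le_add ((norm_sub_le _ _).trans (add_le_add ?_ ?_)) ?_)) ?_)
          all_goals rw [norm_mul]; simp only [nl, ng]; gcongr
      _ ≤ l * (4*y^4/2) + l * (4*y^4/2) + |g| * (2*y^2) + |g| * (2*y^2) := by gcongr
      _ ≤ _ := by nlinarith [mul_nonneg hg (mul_nonneg hl (by positivity : 0 ≤ y^4)), sq_nonneg y]
/-- large parameter -/
def lam (e N : ℕ) : ℝ := N + (e+1)/2

/-- integrand -/
def FF (e N : ℕ) (z0 : ℝ) (p : ℂ) : ℂ :=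
  Complex.exp ((lam e N * (2/(1+z0^2)) : ℝ) * (p-1)) * (2-p)^(N+e) * (p^(N+1))⁻¹

/-- base of the exponential decay -/
def qq (z0 : ℝ) (p : ℂ) : ℂ := Complex.exp ((2/(1+z0^2) : ℝ) * (p-1)) * (2-p) * p⁻¹

/-- amplitude -/
def amp (e : ℕ) (z0 : ℝ) (p : ℂ) : ℂ := Complex.exp (((e+1)/(1+z0^2) : ℝ) * (p-1)) * (2-p)^e * p⁻¹

lemma FF_eq (e N : ℕ) (z0 : ℝ) (p : ℂ) : FF e N z0 p = qq z0 p ^ N * amp e z0 p := by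
  unfold FF qq amp lam
  have : Complex.exp (((N + (e+1)/2) * (2/(1+z0^2)) : ℝ) * (p-1)) =
      Complex.exp ((2/(1+z0^2) : ℝ) * (p-1))^N * Complex.exp (((e+1)/(1+z0^2) : ℝ) * (p-1)) := by
    rw [← Complex.exp_nat_mul, ← Complex.exp_add]
    congr 1
    push_cast; ring
  rw [this, mul_pow, mul_pow, pow_add, pow_succ p N, mul_inv, inv_pow]
  ring

lemma seg1_eq (z0 y : ℝ) : seg1 z0 y = sp z0 + (Complex.I - 1) * y := by
  unfold seg1 sp; push_cast; ring

lemma FF_local (e N : ℕ) (z0 y : ℝ) (hy : |y| ≤ 1/4) :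
    FF e N z0 (seg1 z0 y) = FF e N z0 (sp z0) * Complex.exp (Phi ((e-1)/2) (lam e N) z0 y) := by
  have h2 : √2 ≤ 3/2 := by rw [Real.sqrt_le_left (by norm_num)]; norm_num
  have hw : ∀ z : ℝ, ‖(Complex.I - 1) * y / sp z‖ ≤ 1/2 := by
    intro z
    have := w_norm z y
    have : √2 * |y| ≤ 3/2 * (1/4) := by gcongr
    linarith
  have hne : ∀ w : ℂ, ‖w‖ ≤ 1/2 → 1 + w ≠ 0 := fun w hw =>
    Complex.slitPlane_ne_zero (Complex.mem_slitPlane_of_norm_lt_one (by linarith))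
  have n1 := hne _ (hw z0)
  have n2 := hne (-((Complex.I - 1) * y / sp (-z0))) (by rw [norm_neg]; exact hw _)
  have e1 : (lam e N + (e-1)/2 : ℝ) = ((N + e : ℕ) : ℝ) := by unfold lam; push_cast; ring
  have e2 : (lam e N - (e-1)/2 : ℝ) = ((N + 1 : ℕ) : ℝ) := by unfold lam; push_cast; ring
  unfold Phi
  rw [e1, e2, Complex.exp_sub, Complex.exp_add, Complex.ofReal_natCast, Complex.ofReal_natCast, Complex.exp_nat_mul, Complex.exp_nat_mul, Complex.exp_log n1, Complex.exp_log n2]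
  have s0 := sp_ne z0
  have s1 := sp_ne (-z0)
  have p1 : seg1 z0 y = sp z0 * (1 + (Complex.I - 1) * y / sp z0) := by
    rw [seg1_eq]; field_simp
  have p2 : 2 - seg1 z0 y = (2 - sp z0) * (1 + -((Complex.I - 1) * y / sp (-z0))) := by
    have : 2 - sp z0 = sp (-z0) := by unfold sp; push_cast; ring
    rw [seg1_eq, ← sub_sub, this]; field_simp; ring
  unfold FF
  rw [p2]
  have p3 : Complex.exp ((lam e N * (2/(1+z0^2)) : ℝ) * (seg1 z0 y-1)) =
      Complex.exp ((lam e N * (2/(1+z0^2)) : ℝ) * (sp z0-1)) * Complex.exp ((lam e N * (2/(1+z0^2)) : ℝ) * ((Complex.I - 1) * y)) := by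
    rw [← Complex.exp_add, seg1_eq]; congr 1; ring
  rw [p3, p1, mul_pow, mul_pow, mul_inv]
  ring

lemma qq_norm_sq (z0 : ℝ) (p : ℂ) : ‖qq z0 p‖^2 = Real.exp (4/(1+z0^2) * (p.re - 1)) * Complex.normSq (2-p) / Complex.normSq p := by
  unfold qq
  rw [norm_mul, norm_mul, mul_pow, mul_pow, Complex.norm_exp, ← Real.exp_nat_mul, norm_inv, inv_pow, ← Complex.normSq_eq_norm_sq, ← Complex.normSq_eq_norm_sq, ← div_eq_mul_inv]
  congr 3
  rw [Complex.re_ofReal_mul]; simp; ring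

lemma qq_lt {z0 : ℝ} {p : ℂ} (hp : p ≠ 0)
    (h : Complex.normSq (2-p) < Complex.normSq p * Real.exp (4/(1+z0^2) * (1 - p.re))) : ‖qq z0 p‖ < 1 := by
  have h0 : 0 < Complex.normSq p := Complex.normSq_pos.2 hp
  have : ‖qq z0 p‖^2 < 1 := by
    rw [qq_norm_sq, div_lt_one h0, show 4/(1+z0^2) * (p.re - 1) = -(4/(1+z0^2) * (1 - p.re)) by ring, Real.exp_neg, inv_mul_lt_iff₀ (Real.exp_pos _), mul_comm]
    exact h
  exact (sq_lt_one_iff₀ (norm_nonneg _)).1 this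

lemma exp_two_mul_lt {t : ℝ} (h0 : 0 < t) (h1 : t < 1) : Real.exp (2*t) * (1-t) < 1 + t := by
  have h := hasSum_log_sub_log_of_abs_lt_one (x := t) (by rw [abs_of_pos h0]; exact h1)
  have h2 := sum_le_hasSum (Finset.range 2) (fun k _ => by positivity) h
  simp [Finset.sum_range_succ] at h2
  have h3 : 2 * t < Real.log (1+t) - Real.log (1-t) := by
    have : 0 < 2 * (2+1:ℝ)⁻¹ * t^3 := by positivity
    linarith
  rw [← Real.log_div (by linarith) (by linarith), Real.lt_log_iff_exp_lt (by apply div_pos <;> linarith), lt_div_iff₀ (by linarith)] at h3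
  exact h3

lemma qq_seg1_lt {z0 y : ℝ} (hz : 0 < z0) (hy : -z0 ≤ y) (hy0 : y ≠ 0) : ‖qq z0 (seg1 z0 y)‖ < 1 := by
  have hpos : 0 < (1-y)^2 + (z0+y)^2 := by
    by_cases h1 : y = 1
    · subst h1; nlinarith
    · have : 0 < (1-y)^2 := by
        have : 1 - y ≠ 0 := fun h => h1 (by linarith)
        positivity
      nlinarith [sq_nonneg (z0+y)]
  have hn : Complex.normSq (seg1 z0 y) = (1-y)^2 + (z0+y)^2 := by
    simp [seg1, Complex.normSq_apply]; ring
  have hn2 : Complex.normSq (2 - seg1 z0 y) = (1+y)^2 + (z0+y)^2 := by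
    simp [seg1, Complex.normSq_apply]; ring
  apply qq_lt
  · rw [← Complex.normSq_pos, hn]; exact hpos
  rw [hn, hn2, show (seg1 z0 y).re = 1 - y by simp [seg1], sub_sub_cancel]
  set A := 1 + z0^2 with hA
  set m := A + 2*z0*y + 2*y^2 with hm
  have hA1 : 1 ≤ A := by nlinarith
  rw [show (1+y)^2 + (z0+y)^2 = m + 2*y by rw [hm, hA]; ring, show (1-y)^2 + (z0+y)^2 = m - 2*y by rw [hm, hA]; ring]
  have hpos' : 0 < m - 2*y := by rw [hm, hA]; nlinarith
  rcases lt_or_gt_of_ne hy0 with h | h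
  · obtain ⟨u, rfl⟩ : ∃ u, y = -u := ⟨-y, by ring⟩
    have hu : 0 < u := by linarith
    have huz : u ≤ z0 := by linarith
    have hmA : m ≤ A := by rw [hm]; nlinarith
    rw [show m + 2 * -u = m - 2*u by ring, show m - 2 * -u = m + 2*u by ring, show 4/A * -u = -(4/A*u) by ring, Real.exp_neg,
      ← div_eq_mul_inv, lt_div_iff₀ (Real.exp_pos _)]
    have hmp : 0 < m := by rw [hm]; nlinarith [sq_nonneg (z0 - u)]
    rcases le_or_gt (m - 2*u) 0 with h5 | h5
    · have := Real.exp_pos (4/A*u)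
      nlinarith
    · have ht := exp_two_mul_lt (t := 2*u/m) (by positivity) (by rw [div_lt_one hmp]; linarith)
      have hle : Real.exp (4/A*u) ≤ Real.exp (2*(2*u/m)) := by
        apply Real.exp_le_exp.2
        rw [show 4/A*u = 4*u/A by ring, show 2*(2*u/m) = 4*u/m by ring]
        gcongr
      calc (m - 2*u) * Real.exp (4/A*u) ≤ (m-2*u) * Real.exp (2*(2*u/m)) := by gcongr
        _ = m * (Real.exp (2*(2*u/m)) * (1 - 2*u/m)) := by field_simp
        _ < m * (1 + 2*u/m) := by gcongr
        _ = _ := by field_simp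
  · set v := Real.log ((m+2*y)/(m-2*y)) / 2 with hv
    have hr : 0 < (m+2*y)/(m-2*y) := by apply div_pos _ hpos'; linarith
    have e2v : Real.exp (2*v) = (m+2*y)/(m-2*y) := by rw [hv, mul_div_cancel₀ _ (by norm_num), Real.exp_log hr]
    have hvp : 0 < v := by
      have : 0 < Real.log ((m+2*y)/(m-2*y)) := Real.log_pos (by rw [one_lt_div hpos']; linarith)
      rw [hv]; linarith
    have hsv := Real.self_lt_sinh_iff.2 hvp
    have hmm : A^2 ≤ m^2 - 4*y^2 := by
      rw [hm]
      have h1 : 0 < z0*y := by positivity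
      nlinarith [mul_pos (show 0 < A by linarith) h1, sq_nonneg (2*z0*y+2*y^2), sq_nonneg y]
    have hA0 : 0 < A^2 := by positivity
    have hp2 : 0 < m + 2*y := by linarith
    have hsq : Real.sinh v^2 = 4*y^2/(m^2-4*y^2) := by
      have h1 : Real.exp v * Real.exp (-v) = 1 := by rw [← Real.exp_add]; simp
      have h2 : Real.exp v^2 = (m+2*y)/(m-2*y) := by rw [← e2v, ← Real.exp_nat_mul]; norm_num
      have h3 : Real.exp (-v)^2 = (m-2*y)/(m+2*y) := by
        rw [← inv_div, ← h2, Real.exp_neg, inv_pow]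
      rw [Real.sinh_eq, div_pow, sub_sq, h2, h3, mul_assoc, h1, show m^2 - 4*y^2 = (m-2*y)*(m+2*y) by ring]
      field_simp; ring
    have hle : Real.sinh v ≤ 2*y/A := by
      apply le_of_sq_le_sq _ (by positivity)
      rw [hsq, div_pow, mul_pow]
      norm_num
      gcongr
    have : Real.exp (2*v) < Real.exp (4/A*y) := by
      apply Real.exp_lt_exp.2
      have : 4/A*y = 2*(2*y/A) := by ring
      linarith
    rw [e2v, div_lt_iff₀ hpos'] at this
    linarith

lemma qq_seg2_lt {z0 Y x : ℝ} (hY : 0 < Y) (hzY : 1 + z0^2 < (Y-1)^2) : ‖qq z0 (seg2 Y x)‖ < 1 := by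
  have hn : Complex.normSq (seg2 Y x) = (Y-1)^2 + x^2 := by
    simp [seg2, Complex.normSq_apply]; ring
  have hn2 : Complex.normSq (2 - seg2 Y x) = (Y-1)^2 + x^2 + 4*Y := by
    simp [seg2, Complex.normSq_apply]; ring
  have hpos : 0 < (Y-1)^2 + x^2 := by nlinarith
  apply qq_lt
  · rw [← Complex.normSq_pos, hn]; exact hpos
  rw [hn, hn2, show (seg2 Y x).re = 1 - Y by simp [seg2], sub_sub_cancel]
  have h1 := Real.add_one_le_exp (4/(1+z0^2)*Y)
  have hA : 0 < 1 + z0^2 := by positivity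
  have h2 : 4*Y < ((Y-1)^2 + x^2) * (4/(1+z0^2)*Y) := by
    rw [show ((Y-1)^2 + x^2) * (4/(1+z0^2)*Y) = (((Y-1)^2 + x^2) * (4*Y))/(1+z0^2) by ring, lt_div_iff₀ hA]
    nlinarith [sq_nonneg x]
  nlinarith

lemma exists_lt_one {T : Set (ℝ×ℝ)} (hT : IsCompact T) {f : ℝ × ℝ → ℝ} (hf : ContinuousOn f T) (h1 : ∀ x ∈ T, f x < 1) :
    ∃ q : ℝ, 0 < q ∧ q < 1 ∧ ∀ x ∈ T, f x ≤ q := by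
  rcases T.eq_empty_or_nonempty with rfl | hne
  · exact ⟨1/2, by norm_num, by norm_num, by simp⟩
  · obtain ⟨x, hx, hmax⟩ := hT.exists_isMaxOn hne hf
    refine ⟨max (f x) (1/2), by positivity, max_lt (h1 x hx) (by norm_num), fun y hy => le_max_of_le_left (hmax hy)⟩

lemma pow_lam_bound (e : ℕ) {q : ℝ} (h0 : 0 < q) (h1 : q < 1) : ∃ C : ℝ, 0 < C ∧ ∀ N : ℕ, 1 ≤ N → q^N ≤ C / (lam e N * √(lam e N)) := by
  have ht := tendsto_pow_const_mul_const_pow_of_abs_lt_one 2 (r := q) (by rw [abs_of_pos h0]; exact h1)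
  obtain ⟨B, hB⟩ := ht.bddAbove_range
  have hB' : ∀ N : ℕ, (N:ℝ)^2 * q^N ≤ B := fun N => hB ⟨N, rfl⟩
  have hB1 : 0 < B := lt_of_lt_of_le (by positivity) (hB' 1)
  refine ⟨(e+2)^2 * B, by positivity, fun N hN => ?_⟩
  have hN' : (1:ℝ) ≤ N := by exact_mod_cast hN
  have hl1 : 1 ≤ lam e N := by unfold lam; have : (0:ℝ) ≤ e := by positivity
                               linarith
  have hl2 : lam e N ≤ (e+2)*N := by unfold lam; have : (0:ℝ) ≤ e := by positivity
                                     nlinarith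
  rw [le_div_iff₀ (by positivity)]
  have hs : √(lam e N) ≤ lam e N := by
    rw [Real.sqrt_le_left (by linarith)]; nlinarith
  calc q^N * (lam e N * √(lam e N)) ≤ q^N * (((e+2)*N) * ((e+2)*N)) := by gcongr; linarith
    _ = (e+2)^2 * ((N:ℝ)^2 * q^N) := by ring
    _ ≤ _ := by gcongr; exact hB' N

lemma tail_bound (e : ℕ) {T : Set (ℝ×ℝ)} (hT : IsCompact T) {P : ℝ → ℝ → ℂ} (hP : Continuous (fun x : ℝ × ℝ => P x.1 x.2))
    (h0 : ∀ x ∈ T, P x.1 x.2 ≠ 0) (h1 : ∀ x ∈ T, ‖qq x.1 (P x.1 x.2)‖ < 1) :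
    ∃ C : ℝ, 0 < C ∧ ∀ N : ℕ, 1 ≤ N → ∀ z y : ℝ, (z,y) ∈ T → ‖FF e N z (P z y)‖ ≤ C / (lam e N * √(lam e N)) := by
  have hinv : ContinuousOn (fun x : ℝ × ℝ => (P x.1 x.2)⁻¹) T := hP.continuousOn.inv₀ h0
  have hd : ∀ x : ℝ × ℝ, 1 + x.1^2 ≠ 0 := fun x => by positivity
  have cq : ContinuousOn (fun x : ℝ × ℝ => qq x.1 (P x.1 x.2)) T := by
    unfold qq
    refine ContinuousOn.mul (Continuous.continuousOn ?_) hinv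
    have : Continuous (fun x : ℝ × ℝ => 2/(1+x.1^2)) := Continuous.div (by fun_prop) (by fun_prop) hd
    fun_prop
  have ca : ContinuousOn (fun x : ℝ × ℝ => amp e x.1 (P x.1 x.2)) T := by
    unfold amp
    refine ContinuousOn.mul (Continuous.continuousOn ?_) hinv
    have : Continuous (fun x : ℝ × ℝ => ((e:ℝ)+1)/(1+x.1^2)) := Continuous.div (by fun_prop) (by fun_prop) hd
    fun_prop
  obtain ⟨q, hq0, hq1, hq⟩ := exists_lt_one hT cq.norm h1
  obtain ⟨B, hB⟩ := hT.exists_bound_of_continuousOn ca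
  obtain ⟨C, hC, hCb⟩ := pow_lam_bound e hq0 hq1
  refine ⟨C * (|B|+1), by positivity, fun N hN z y hzy => ?_⟩
  rw [FF_eq, norm_mul, norm_pow, mul_div_right_comm]
  have hl : 0 ≤ lam e N := by unfold lam; positivity
  have h3 := hq _ hzy
  have h4 := hB _ hzy
  simp only at h3 h4
  gcongr
  · exact (pow_le_pow_left₀ (norm_nonneg _) h3 N).trans (hCb N hN)
  · linarith [le_abs_self B]
lemma sp_polar (z0 : ℝ) : sp z0 = (√(1+z0^2) : ℝ) * Complex.exp (Real.arctan z0 * Complex.I) := by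
  have hp : (0:ℝ) < √(1+z0^2) := by positivity
  rw [Complex.exp_mul_I, ← Complex.ofReal_cos, ← Complex.ofReal_sin, Real.cos_arctan, Real.sin_arctan]
  unfold sp
  have : ((√(1+z0^2) : ℝ) : ℂ) ≠ 0 := by exact_mod_cast hp.ne'
  push_cast
  field_simp

lemma FF_sp (e N : ℕ) (z0 : ℝ) : FF e N z0 (sp z0) = ((√(1+z0^2)^e / √(1+z0^2) : ℝ) : ℂ) *
    Complex.exp ((2 * lam e N * (z0/(1+z0^2) - Real.arctan z0) : ℝ) * Complex.I) := by
  have h2 : 2 - sp z0 = (√(1+z0^2) : ℝ) * Complex.exp (-(Real.arctan z0 * Complex.I)) := by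
    have := sp_polar (-z0)
    rw [Real.arctan_neg, neg_sq] at this
    rw [show 2 - sp z0 = sp (-z0) by unfold sp; push_cast; ring, this]
    congr 2; push_cast; ring
  have hp : (0:ℝ) < √(1+z0^2) := by positivity
  have hp' : ((√(1+z0^2) : ℝ) : ℂ) ≠ 0 := by exact_mod_cast hp.ne'
  unfold FF
  rw [h2]
  have h3 : sp z0 - 1 = z0 * Complex.I := by unfold sp; ring
  rw [h3, sp_polar, mul_pow, mul_pow, mul_inv, ← Complex.exp_nat_mul, ← Complex.exp_nat_mul, ← Complex.exp_neg]
  set ρ := √(1+z0^2)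
  have h4 : Complex.exp ((2 * lam e N * (z0/(1+z0^2) - Real.arctan z0) : ℝ) * Complex.I) =
     Complex.exp ((lam e N * (2/(1+z0^2)) : ℝ) * (z0 * Complex.I)) * Complex.exp ((N+e:ℕ) * -(Real.arctan z0 * Complex.I)) *
       Complex.exp (-((N+1:ℕ) * (Real.arctan z0 * Complex.I))) := by
    rw [← Complex.exp_add, ← Complex.exp_add]
    congr 1
    unfold lam
    push_cast; ring
  rw [h4]
  push_cast
  rw [pow_add, pow_succ]
  field_simp
  ring

lemma FF_cont (e N : ℕ) (z0 : ℝ) : ContinuousOn (FF e N z0) upS := by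
  unfold FF
  refine ContinuousOn.mul (Continuous.continuousOn (by fun_prop)) (ContinuousOn.inv₀ (Continuous.continuousOn (by fun_prop)) fun p hp => pow_ne_zero _ hp.2)

lemma J_asymp (e : ℕ) {zmin zmax : ℝ} (h0 : 0 < zmin) (hm : zmin ≤ zmax) : ∃ C : ℝ, 0 < C ∧ ∀ N : ℕ, 1 ≤ N → ∀ z0 : ℝ,
    zmin ≤ z0 → z0 ≤ zmax →
    ‖PI z0 (2+zmax) (FF e N z0) - (Complex.I - 1) * (FF e N z0 (sp z0) * (√(π / (4 * z0/(1+z0^2)^2 * lam e N)) : ℝ))‖ ≤ C / (lam e N * √(lam e N)) := by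
  set K : ℝ := 4 + 4 * |((e:ℝ)-1)/2| with hK
  have hKp : 0 < K := by positivity
  set κ0 : ℝ := 4 * zmin / (1+zmax^2)^2 with hκ0
  have hκ0p : 0 < κ0 := by positivity
  set δ : ℝ := min (1/4) (min zmin (κ0/(8*K))) with hδ
  have hδp : 0 < δ := by positivity
  have hδ4 : δ ≤ 1/4 := min_le_left _ _
  have hδz : δ ≤ zmin := (min_le_right _ _).trans (min_le_left _ _)
  have hδK : 8 * K * δ ≤ κ0 := by
    have : δ ≤ κ0/(8*K) := (min_le_right _ _).trans (min_le_right _ _)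
    rw [le_div_iff₀ (by positivity)] at this; linarith
  have hzm : 0 < zmax := by linarith
  set Y : ℝ := 2 + zmax with hY
  have hYp : 0 < Y := by linarith
  obtain ⟨C1, hC1, hL⟩ := laplace hκ0p hKp hδp (by linarith) hδK
  -- compact sets
  set T1 : Set (ℝ×ℝ) := (Set.Icc zmin zmax ×ˢ Set.Icc (-zmax) Y) ∩ ({x | -x.1 ≤ x.2} ∩ {x | δ ≤ |x.2|}) with hT1
  have cT1 : IsCompact T1 := by
    refine (isCompact_Icc.prod isCompact_Icc).inter_right ((isClosed_le ?_ ?_).inter (isClosed_le ?_ ?_)) <;> fun_prop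
  obtain ⟨C2, hC2, hb2⟩ := tail_bound e cT1 (P := seg1) (by unfold seg1; fun_prop)
    (fun x hx => (seg1_mem (Y := Y) (lt_of_lt_of_le h0 hx.1.1.1) (by linarith) (by
      rw [Set.uIcc_of_le (by have := hx.1.1.1; linarith)]
      exact ⟨hx.2.1, hx.1.2.2⟩)).2)
    (fun x hx => qq_seg1_lt (lt_of_lt_of_le h0 hx.1.1.1) hx.2.1 (by
      intro h; have := hx.2.2; simp [h] at this; linarith))
  obtain ⟨C3, hC3, hb3⟩ := tail_bound e (T := Set.Icc zmin zmax ×ˢ Set.Icc 0 (zmax+Y)) (isCompact_Icc.prod isCompact_Icc) (P := fun _ x => seg2 Y x) (by unfold seg2; fun_prop)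
    (fun x hx => (seg2_mem (z0 := zmax) (Y := Y) (by linarith) (by linarith) (by
      rw [Set.uIcc_of_ge (by linarith)]
      exact hx.2)).2)
    (fun x hx => qq_seg2_lt (by linarith) (by
      have h1 := hx.1.1; have h2 := hx.1.2
      rw [hY]; nlinarith))
  set B : ℝ := √2 * √(1+zmax^2)^e with hB
  refine ⟨B * C1 + 2 * √2 * (zmax + Y) * C2 + (zmax+Y) * C3, by positivity, ?_⟩
  intro N hN z0 hz1 hz2
  have hz0 : 0 < z0 := by linarith
  have hN' : (1:ℝ) ≤ N := by exact_mod_cast hN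
  have hl1 : 1 ≤ lam e N := by
    unfold lam; have : (0:ℝ) ≤ e := by positivity
    linarith
  set l := lam e N with hl
  set M := l * √l with hM
  have hMp : 0 < M := by positivity
  obtain ⟨a1, b3, ha1, hb3', hexp⟩ := Phi_exp (((e:ℝ)-1)/2) l z0 (by linarith)
  have hκ : κ0 ≤ 4 * z0/(1+z0^2)^2 := by
    rw [hκ0]; gcongr
  have hlap := hL (4 * z0/(1+z0^2)^2) l a1 b3 (Phi (((e:ℝ)-1)/2) l z0) hκ hl1 ha1 hb3'
    ((Phi_cont _ _ _).mono (Set.Icc_subset_Icc (by linarith) hδ4)) (fun y hy => hexp y (hy.trans hδ4))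
  have hii := ii1 hz0 (show 1 < Y by linarith) (FF_cont e N z0)
  have hsub : ∀ a b : ℝ, -z0 ≤ a → a ≤ b → b ≤ Y → IntervalIntegrable (fun y => FF e N z0 (seg1 z0 y) * (Complex.I - 1)) volume a b := by
    intro a b h1 h2 h3
    refine hii.mono_set ?_
    rw [Set.uIcc_of_le h2, Set.uIcc_of_le (by linarith)]
    exact Set.Icc_subset_Icc h1 h3
  have hsplit : PI z0 Y (FF e N z0) = (∫ y in (-z0)..(-δ), FF e N z0 (seg1 z0 y) * (Complex.I - 1))
     + (∫ y in (-δ)..δ, FF e N z0 (seg1 z0 y) * (Complex.I - 1)) + (∫ y in δ..Y, FF e N z0 (seg1 z0 y) * (Complex.I - 1))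
     + ∫ x in (z0+Y)..0, FF e N z0 (seg2 Y x) * Complex.I := by
    rw [intervalIntegral.integral_add_adjacent_intervals (hsub _ _ (by linarith) (by linarith) (by linarith)) (hsub _ _ (by linarith) (by linarith) (by linarith)),
      intervalIntegral.integral_add_adjacent_intervals (hsub _ _ (by linarith) (by linarith) (by linarith)) (hsub _ _ (by linarith) (by linarith) (by linarith))]
    rfl
  have hmid : (∫ y in (-δ)..δ, FF e N z0 (seg1 z0 y) * (Complex.I - 1)) =
      (Complex.I - 1) * (FF e N z0 (sp z0) * ∫ y in (-δ)..δ, Complex.exp (Phi (((e:ℝ)-1)/2) l z0 y)) := by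
    rw [← intervalIntegral.integral_const_mul, ← intervalIntegral.integral_const_mul]
    refine intervalIntegral.integral_congr fun y hy => ?_
    rw [Set.uIcc_of_le (by linarith)] at hy
    rw [FF_local e N z0 y ((abs_le.2 hy).trans hδ4)]
    ring
  have hFn : ‖FF e N z0 (sp z0)‖ ≤ √(1+zmax^2)^e := by
    rw [FF_sp, norm_mul, Complex.norm_exp_ofReal_mul_I, mul_one, Complex.norm_real, Real.norm_of_nonneg (by positivity)]
    have h1 : 1 ≤ √(1+z0^2) := by rw [Real.one_le_sqrt]; nlinarith
    refine (div_le_self (by positivity) h1).trans ?_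
    gcongr
  have t1 : ‖∫ y in (-z0)..(-δ), FF e N z0 (seg1 z0 y) * (Complex.I - 1)‖ ≤ √2 * (zmax+Y) * C2 / M := by
    have := intervalIntegral.norm_integral_le_of_norm_le_const (C := C2/M * √2) (f := fun y => FF e N z0 (seg1 z0 y) * (Complex.I - 1)) (a := -z0) (b := -δ) (fun y hy => by
      rw [Set.uIoc_of_le (by linarith)] at hy
      rw [norm_mul, eta_norm]
      gcongr
      refine hb2 N hN z0 y ⟨⟨⟨hz1, hz2⟩, ⟨by linarith [hy.1], by linarith [hy.2]⟩⟩, hy.1.le, ?_⟩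
      show δ ≤ |y|
      rw [le_abs]; right; linarith [hy.2])
    refine this.trans ?_
    rw [show √2 * (zmax+Y) * C2 / M = C2/M*√2 * (zmax+Y) by ring]
    gcongr
    rw [abs_le]; constructor <;> linarith
  have t2 : ‖∫ y in δ..Y, FF e N z0 (seg1 z0 y) * (Complex.I - 1)‖ ≤ √2 * (zmax+Y) * C2 / M := by
    have := intervalIntegral.norm_integral_le_of_norm_le_const (C := C2/M * √2) (f := fun y => FF e N z0 (seg1 z0 y) * (Complex.I - 1)) (a := δ) (b := Y) (fun y hy => by
      rw [Set.uIoc_of_le (by linarith)] at hy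
      rw [norm_mul, eta_norm]
      gcongr
      refine hb2 N hN z0 y ⟨⟨⟨hz1, hz2⟩, ⟨by linarith [hy.1], by linarith [hy.2]⟩⟩, ?_, ?_⟩
      · show -z0 ≤ y
        linarith [hy.1]
      · show δ ≤ |y|
        rw [le_abs]; left; linarith [hy.1])
    refine this.trans ?_
    rw [show √2 * (zmax+Y) * C2 / M = C2/M*√2 * (zmax+Y) by ring]
    gcongr
    rw [abs_le]; constructor <;> linarith
  have t3 : ‖∫ x in (z0+Y)..0, FF e N z0 (seg2 Y x) * Complex.I‖ ≤ (zmax+Y) * C3 / M := by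
    have := intervalIntegral.norm_integral_le_of_norm_le_const (C := C3/M) (f := fun y => FF e N z0 (seg2 Y y) * Complex.I) (a := z0+Y) (b := 0) (fun y hy => by
      rw [Set.uIoc_of_ge (by linarith)] at hy
      rw [norm_mul, Complex.norm_I, mul_one]
      exact hb3 N hN z0 y ⟨⟨hz1, hz2⟩, ⟨hy.1.le, by linarith [hy.2]⟩⟩)
    refine this.trans ?_
    rw [show (zmax+Y) * C3 / M = C3/M * (zmax+Y) by ring]
    gcongr
    rw [abs_le]; constructor <;> linarith
  have t0 : ‖(Complex.I - 1) * (FF e N z0 (sp z0) * ((∫ y in (-δ)..δ, Complex.exp (Phi (((e:ℝ)-1)/2) l z0 y)) - (√(π / (4 * z0/(1+z0^2)^2 * l)) : ℝ)))‖ ≤ B * C1 / M := by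
    rw [norm_mul, norm_mul, eta_norm]
    calc _ ≤ √2 * (√(1+zmax^2)^e * (C1/M)) := by gcongr
      _ = _ := by rw [hB]; ring
  rw [hsplit, hmid]
  rw [show ∀ u v w a b f g h : ℂ, u + a * (f * g) + v + w - a * (f * h) = a * (f * (g - h)) + u + v + w by intros; ring]
  · refine (norm_add_le _ _).trans ((add_le_add ((norm_add_le _ _).trans (add_le_add ((norm_add_le _ _).trans (add_le_add t0 t1)) t2)) t3).trans (le_of_eq ?_))
    ring
  · exact 0
lemma rpow_split {h : ℝ} (hh : 0 < h) (e : ℕ) : h ^ (-((e+1:ℕ):ℝ) + 1/2) = (h^(e+1))⁻¹ * √h := by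
  rw [Real.rpow_add hh, Real.rpow_neg hh.le, Real.rpow_natCast, Real.sqrt_eq_rpow]

lemma rpow_split3 {h : ℝ} (hh : 0 < h) (e : ℕ) : h ^ (-((e+1:ℕ):ℝ) + 3/2) = (h^(e+1))⁻¹ * (h * √h) := by
  rw [show (-((e+1:ℕ):ℝ) + 3/2) = -((e+1:ℕ):ℝ) + 1/2 + 1 by ring, Real.rpow_add hh, rpow_split hh, Real.rpow_one]; ring

lemma coeff_eq (e : ℕ) {E hb l z s ρ : ℝ} (hE : 0 < E) (hh : 0 < hb) (hl : l = E/hb) (hz : 0 < z) (hs : s⁻¹ = 1 + z^2) (hρ : ρ = √(1+z^2)) :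
    ((π * hb)^(e+1))⁻¹ / (π * 2^e) * ((ρ^e/ρ) * √2 * √(π / (4 * z/(1+z^2)^2 * l))) =
    (2*π*hb)^(-((e+1:ℕ):ℝ) + 1/2) * (π * √E * (s⁻¹ - 1)^((1:ℝ)/4) * s^(((e+1:ℕ):ℝ)/2))⁻¹ := by
  have hA : (0:ℝ) < 1 + z^2 := by positivity
  have hρp : 0 < ρ := by rw [hρ]; positivity
  have hρ2 : ρ^2 = 1 + z^2 := by rw [hρ, Real.sq_sqrt hA.le]
  have hs' : s = (ρ^2)⁻¹ := by rw [hρ2, ← hs, inv_inv]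
  have h1 : s^(((e+1:ℕ):ℝ)/2) = (ρ^(e+1))⁻¹ := by
    rw [hs', Real.inv_rpow (by positivity), ← Real.rpow_natCast ρ 2, ← Real.rpow_mul hρp.le, ← Real.rpow_natCast ρ (e+1)]
    congr 2; push_cast; ring
  have h2 : (s⁻¹ - 1)^((1:ℝ)/4) = √z := by
    rw [hs, add_sub_cancel_left, ← Real.rpow_natCast z 2, ← Real.rpow_mul hz.le, Real.sqrt_eq_rpow]
    norm_num
  have h3 : √(π / (4 * z/(1+z^2)^2 * l)) = √π * ρ^2 * √hb / (2 * √z * √E) := by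
    rw [show π / (4 * z/(1+z^2)^2 * l) = π * (ρ^2)^2 * hb / (2^2 * z * E) by rw [← hρ2, hl]; field_simp; norm_num,
      Real.sqrt_div (by positivity), Real.sqrt_mul (by positivity), Real.sqrt_mul (by positivity), Real.sqrt_sq (by positivity),
      Real.sqrt_mul (by positivity), Real.sqrt_mul (by positivity), Real.sqrt_sq (by positivity)]
  rw [h1, h2, h3, rpow_split (by positivity), Real.sqrt_mul (by positivity), Real.sqrt_mul (by positivity), mul_pow (2*π) hb, mul_pow 2 π, mul_pow π hb]
  have : 0 < √z := by positivity
  have : 0 < √E := by positivity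
  field_simp
  ring

lemma im_main (ψ : ℝ) (r R : ℝ) : ((Complex.I - 1) * (((r:ℝ):ℂ) * Complex.exp ((ψ:ℝ) * Complex.I) * (R:ℝ))).im = r * √2 * R * Real.cos (-(π/4) - ψ) := by
  have h : Real.cos (-(π/4) - ψ) = √2/2 * (Real.cos ψ - Real.sin ψ) := by
    rw [Real.cos_sub, Real.cos_neg, Real.sin_neg, Real.cos_pi_div_four, Real.sin_pi_div_four]; ring
  rw [h, Complex.exp_mul_I, ← Complex.ofReal_cos, ← Complex.ofReal_sin]
  have h2 : √2 * √2 = 2 := Real.mul_self_sqrt (by norm_num)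
  generalize Real.cos ψ = u
  generalize Real.sin ψ = v
  simp
  linear_combination (-(r*R*(u - v)/2)) * h2

lemma wigner_im (e N : ℕ) {hb z0 Y : ℝ} (hh : 0 < hb) (hz : 0 < z0) (hY : 1 < Y) (x ξ : Fin (e+1) → ℝ)
    (hc : 2 * Hfun x ξ / hb = lam e N * (2/(1+z0^2))) :
    wigner (e+1) hb N x ξ = ((((π * hb)^(e+1))⁻¹ / (π * 2^e) * (PI z0 Y (FF e N z0)).im : ℝ) : ℂ) := by
  have hlp : 0 < lam e N := by unfold lam; positivity
  set c := lam e N * (2/(1+z0^2)) with hcdef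
  have hcp : 0 < c := by positivity
  have h1 := PI_lag hz hY hcp.ne' e N
  have h2 : FF e N z0 = fun p => ((Real.exp (-c) : ℝ) : ℂ) * (Complex.exp (c * p) * (2 - p)^(N+e) * (p^(N+1))⁻¹) := by
    funext p
    unfold FF
    rw [← hcdef, show (c:ℂ) * (p-1) = ((-c : ℝ) : ℂ) + c * p by push_cast; ring, Complex.exp_add, ← Complex.ofReal_exp]
    ring
  rw [wigner_eq e N hb hh, h2, PI_mul, Complex.im_ofReal_mul, h1, hc, show 4 * Hfun x ξ / hb = 2 * c by rw [← hc]; ring]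
  congr 1
  field_simp

lemma mul_sub_ofReal_aux (a b c : ℝ) : ((a * (b - c) : ℝ) : ℂ) = ((a * b : ℝ) : ℂ) - ((a * c : ℝ) : ℂ) := by
  push_cast; ring

/-- **Interior trigonometric asymptotics** of the Wigner distribution, uniformly on
compact subsets of the interior of the energy ball. -/
theorem wigner_interior_asymptotics (d : ℕ) (hd : 1 ≤ d) (E : ℝ) (hE : 0 < E)
    (a b : ℝ) (ha : 0 < a) (hab : a ≤ b) (hb1 : b < 1) :
    ∃ C : ℝ, 0 < C ∧ ∃ N₀ : ℕ, ∀ N : ℕ, N₀ ≤ N → ∀ hb : ℝ, hb = hPl d E N →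
      ∀ x ξ : Fin d → ℝ, a ≤ Hfun x ξ / E → Hfun x ξ / E ≤ b →
        norm (wigner d hb N x ξ -
            (((2 * π * hb) ^ (-(d : ℝ) + 1 / 2) *
              (π * Real.sqrt E * ((Hfun x ξ / E)⁻¹ - 1) ^ ((1 : ℝ) / 4) *
                (Hfun x ξ / E) ^ ((d : ℝ) / 2))⁻¹ *
              Real.cos (-(π / 4) - (2 * Hfun x ξ / hb) * Real.sqrt ((Hfun x ξ / E)⁻¹ - 1) +
                (2 * E / hb) * Real.arccos (Real.sqrt (Hfun x ξ / E))) : ℝ) : ℂ)) ≤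
          C * hb ^ (-(d : ℝ) + 3 / 2) := by
  obtain ⟨e, rfl⟩ : ∃ e, d = e + 1 := ⟨d - 1, by omega⟩
  have hb0 : 0 < b := by linarith
  have hzmin : 0 < √(b⁻¹ - 1) := by
    apply Real.sqrt_pos.2
    have := (one_lt_inv₀ hb0).2 hb1
    linarith
  have hzz : √(b⁻¹ - 1) ≤ √(a⁻¹ - 1) := by
    apply Real.sqrt_le_sqrt
    have := inv_anti₀ ha hab
    linarith
  obtain ⟨C, hC, hJ⟩ := J_asymp e hzmin hzz
  refine ⟨C / (π^(e+1) * (π * 2^e) * (E * √E)), by positivity, 1, ?_⟩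
  intro N hN hb hhb x ξ hsa hsb
  have hlE : lam e N = E / hb := by
    rw [hhb]; unfold hPl lam
    have : ((N:ℝ) + ((e+1:ℕ):ℝ)/2) ≠ 0 := by positivity
    push_cast at this ⊢
    field_simp
  have hh : 0 < hb := by rw [hhb]; unfold hPl; positivity
  set s := Hfun x ξ / E with hs
  have hs0 : 0 < s := by linarith
  have hHs : Hfun x ξ = s * E := by rw [hs]; field_simp
  have hs1 : 0 < s⁻¹ - 1 := by
    have := (one_lt_inv₀ hs0).2 (by linarith)
    linarith
  set z := √(s⁻¹ - 1) with hz
  have hzp : 0 < z := Real.sqrt_pos.2 hs1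
  have hz2 : z^2 = s⁻¹ - 1 := Real.sq_sqrt hs1.le
  have hsi : s⁻¹ = 1 + z^2 := by rw [hz2]; ring
  have hz1 : √(b⁻¹ - 1) ≤ z := by
    apply Real.sqrt_le_sqrt
    have := inv_anti₀ hs0 hsb
    linarith
  have hz3 : z ≤ √(a⁻¹ - 1) := by
    apply Real.sqrt_le_sqrt
    have := inv_anti₀ ha hsa
    linarith
  have hss : (1 + z^2)⁻¹ = s := by rw [← hsi, inv_inv]
  have hc : 2 * Hfun x ξ / hb = lam e N * (2/(1+z^2)) := by
    rw [hlE, div_eq_mul_inv 2 (1+z^2), hss, hHs]; ring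
  have harc : Real.arccos (√s) = Real.arctan z := by
    rw [Real.arccos_eq_arctan (Real.sqrt_pos.2 hs0), Real.sq_sqrt hs0.le, ← Real.sqrt_div' _ hs0.le, hz]
    congr 2
    field_simp
  have hY : 1 < 2 + √(a⁻¹ - 1) := by
    have := Real.sqrt_nonneg (a⁻¹ - 1)
    linarith
  have hJ' := hJ N hN z hz1 hz3
  rw [wigner_im e N hh hzp hY x ξ hc, ← coeff_eq e hE hh hlE hzp hsi rfl]
  have hcos : -(π / 4) - (2 * Hfun x ξ / hb) * z + (2 * E / hb) * Real.arccos (√s) =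
      -(π/4) - 2 * lam e N * (z/(1+z^2) - Real.arctan z) := by
    rw [harc, hc, hlE]; ring
  rw [hcos, mul_assoc, ← im_main, ← FF_sp, ← mul_sub_ofReal_aux, Complex.norm_real, norm_mul, Real.norm_eq_abs, Real.norm_eq_abs,
    ← Complex.sub_im, abs_of_pos (by positivity), rpow_split3 hh]
  refine (mul_le_mul_of_nonneg_left ((Complex.abs_im_le_norm _).trans hJ') (by positivity)).trans (le_of_eq ?_)
  rw [hlE, Real.sqrt_div hE.le, mul_pow]
  have : 0 < √hb := by positivity
  have : 0 < √E := by positivity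
  field_simp
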